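/- arXiv:2311.00352 — 2 statements merged into one kernel-verified Lean document; each statement's English description precedes it below -/
import Mathlib

section
/- Let G be a finitely generated minimal non-nilpotent group. If G has a proper subgroup of finite index, then G is finite. In particular, every locally graded finitely generated minimal non-nilpotent group is finite. -/
/-- A group is *minimal non-nilpotent* if it is not nilpotent but every proper
subgroup of it is nilpotent. -/
def MinimalNonNilpotent (G : Type*) [Group G] : Prop :=
  ¬ Group.IsNilpotent G ∧ ∀ H : Subgroup G, H ≠ ⊤ → Group.IsNilpotent H

/-- A group is *biminimal non-nilpotent* if it is neither nilpotent nor minimal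
non-nilpotent, but every proper subgroup of it is nilpotent or minimal non-nilpotent. -/
def BiminimalNonNilpotent (G : Type*) [Group G] : Prop :=
  ¬ Group.IsNilpotent G ∧ ¬ MinimalNonNilpotent G ∧
    ∀ H : Subgroup G, H ≠ ⊤ → (Group.IsNilpotent H ∨ MinimalNonNilpotent H)

/-- A group is *para-Nil-Hamiltonian* if it is not nilpotent and every non-normal
subgroup of it is either nilpotent or minimal non-nilpotent. -/
def ParaNilHamiltonian (G : Type*) [Group G] : Prop :=
  ¬ Group.IsNilpotent G ∧
    ∀ H : Subgroup G, ¬ H.Normal → (Group.IsNilpotent H ∨ MinimalNonNilpotent H)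

/-- A group is *meta-Nil-Hamiltonian* if every non-nilpotent subgroup of it is normal. -/
def MetaNilHamiltonian (G : Type*) [Group G] : Prop :=
  ∀ H : Subgroup G, ¬ Group.IsNilpotent H → H.Normal

/-- A group is *locally graded* if every non-trivial finitely generated subgroup of it
contains a proper subgroup of finite index. -/
def LocallyGraded (G : Type*) [Group G] : Prop :=
  ∀ H : Subgroup G, H ≠ ⊥ → Group.FG H → ∃ K : Subgroup H, K ≠ ⊤ ∧ K.FiniteIndex

/-- A group is abelian if its multiplication commutes. -/
def Abelian (G : Type*) [Group G] : Prop := ∀ a b : G, a * b = b * a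

/-- A group is *minimal non-abelian* if it is not abelian but every proper
subgroup of it is abelian. -/
def MinimalNonAbelian (G : Type*) [Group G] : Prop :=
  ¬ Abelian G ∧ ∀ H : Subgroup G, H ≠ ⊤ → Abelian H

/-- A group is *biminimal non-abelian* if it is neither abelian nor minimal non-abelian,
but every proper subgroup of it is abelian or minimal non-abelian. -/
def BiminimalNonAbelian (G : Type*) [Group G] : Prop :=
  ¬ Abelian G ∧ ¬ MinimalNonAbelian G ∧
    ∀ H : Subgroup G, H ≠ ⊤ → (Abelian H ∨ MinimalNonAbelian H)

/-- A group is *parahamiltonian* if it is not abelian and every non-normal subgroup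
of it is either abelian or minimal non-abelian. -/
def Parahamiltonian (G : Type*) [Group G] : Prop :=
  ¬ Abelian G ∧ ∀ H : Subgroup G, ¬ H.Normal → (Abelian H ∨ MinimalNonAbelian H)

/-- A group is *locally nilpotent* if every finitely generated subgroup of it is nilpotent. -/
def LocallyNilpotent (G : Type*) [Group G] : Prop :=
  ∀ H : Subgroup G, Group.FG H → Group.IsNilpotent H

open Subgroup
open scoped commutatorElement

/-- If `G = HN` and `N` centralizes the normal subgroup `X` modulo a term of the upper central
series of `G`, then the upper central series of `H` is, inside `X`, controlled by that of `G`. -/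
theorem mem_upperCentralSeries_add_of_sup_eq_top {G : Type*} [Group G] {H N X : Subgroup G}
    [X.Normal] (hHN : H ⊔ N = ⊤) {k : ℕ}
    (hXN : ∀ x ∈ X, ∀ n ∈ N, ⁅x, n⁆ ∈ Subgroup.upperCentralSeries G k) (j : ℕ) (x : H)
    (hx : x ∈ Subgroup.upperCentralSeries H j) (hxX : (x : G) ∈ X) :
    (x : G) ∈ Subgroup.upperCentralSeries G (k + j) := by
  induction j generalizing x with
  | zero =>
    rw [Subgroup.upperCentralSeries_zero, mem_bot] at hx
    simp [hx]
  | succ j ih =>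
    rw [← add_assoc, Subgroup.mem_upperCentralSeries_succ_iff]
    have hmk (g : G) : ⁅(x : G), g⁆ ∈ Subgroup.upperCentralSeries G (k + j) ↔
        g ∈ (centralizer {QuotientGroup.mk' (Subgroup.upperCentralSeries G (k + j)) x}).comap
          (QuotientGroup.mk' (Subgroup.upperCentralSeries G (k + j))) := by
      rw [mem_comap, mem_centralizer_singleton_iff, ← map_mul, ← map_mul,
        QuotientGroup.mk'_apply, QuotientGroup.mk'_apply, eq_comm, QuotientGroup.eq_iff_div_mem,
        commutatorElement_def, div_eq_mul_inv, mul_inv_rev, ← mul_assoc]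
    have hle : H ⊔ N ≤ (centralizer {QuotientGroup.mk' (Subgroup.upperCentralSeries G (k + j)) x}).comap
          (QuotientGroup.mk' (Subgroup.upperCentralSeries G (k + j))) := by
      refine sup_le (fun h hh ↦ ?_) (fun n hn ↦ ?_)
      · rw [← hmk]
        refine ih ⁅x, ⟨h, hh⟩⁆ (Subgroup.mem_upperCentralSeries_succ_iff.mp hx _) ?_
        have := X.mul_mem hxX (Normal.conj_mem inferInstance _ (X.inv_mem hxX) h)
        simpa [commutatorElement_def, mul_assoc] using this
      · rw [← hmk]
        exact Subgroup.upperCentralSeries_mono _ (Nat.le_add_right k j) (hXN x hxX n hn)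
    intro g
    rw [hmk]
    exact hle (hHN ▸ mem_top g)

/-- If `G = HN` with `H` and `N` nilpotent and `N` normal, then every normal subgroup of `G`
contained in `H ∩ N` lies in a term of the upper central series of `G`. -/
theorem exists_le_upperCentralSeries {G : Type*} [Group G] {H N M : Subgroup G}
    [N.Normal] [M.Normal] [hH : Group.IsNilpotent H] [hN : Group.IsNilpotent N]
    (hHN : H ⊔ N = ⊤) (hMH : M ≤ H) (hMN : M ≤ N) :
    ∃ k, M ≤ Subgroup.upperCentralSeries G k := by
  obtain ⟨c, hc⟩ := hN.nilpotent
  obtain ⟨d, hd⟩ := hH.nilpotent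
  have key (i : ℕ) :
      ∃ k, M ⊓ (Subgroup.upperCentralSeries N i).map N.subtype ≤ Subgroup.upperCentralSeries G k := by
    induction i with
    | zero => exact ⟨0, by simp⟩
    | succ i ih =>
      obtain ⟨k, hk⟩ := ih
      refine ⟨k + d, fun x hx ↦ ?_⟩
      refine mem_upperCentralSeries_add_of_sup_eq_top
        (X := M ⊓ (Subgroup.upperCentralSeries N (i + 1)).map N.subtype) hHN ?_ d
        ⟨x, hMH hx.1⟩ (hd ▸ mem_top _) hx
      rintro _ ⟨hyM, y, hy, rfl⟩ n hn
      refine hk ⟨?_, ⁅y, ⟨n, hn⟩⁆, Subgroup.mem_upperCentralSeries_succ_iff.mp hy _, by simp⟩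
      have := M.mul_mem hyM (Normal.conj_mem inferInstance _ (M.inv_mem hyM) n)
      simpa [commutatorElement_def, mul_assoc] using this
  obtain ⟨k, hk⟩ := key c
  exact ⟨k, fun x hx ↦ hk ⟨hx, ⟨x, hMN hx⟩, by simp [hc], rfl⟩⟩

/-- A nilpotent group with finite abelianization is finite. -/
theorem finite_of_finite_abelianization (G : Type*) [Group G] [Group.IsNilpotent G]
    (h : Finite (Abelianization G)) : Finite G := by
  refine Group.nilpotent_center_quotient_ind
    (P := fun G _ _ ↦ Finite (Abelianization G) → Finite G) G ?_ ?_ h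
  · exact fun G _ _ _ ↦ inferInstance
  · intro G _ _ ih h
    have hsurj : Function.Surjective (Abelianization.map (QuotientGroup.mk' (center G))) := by
      intro y
      obtain ⟨q, rfl⟩ := QuotientGroup.mk_surjective y
      obtain ⟨g, rfl⟩ := QuotientGroup.mk_surjective q
      exact ⟨Abelianization.of g, Abelianization.map_of _ _⟩
    have : Finite (G ⧸ center G) := ih (Finite.of_surjective _ hsurj)
    have hout (g : G) : ∃ z ∈ center G, g = (g : G ⧸ center G).out * z := by
      refine ⟨(g : G ⧸ center G).out⁻¹ * g, ?_, by group⟩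
      rw [← QuotientGroup.eq, QuotientGroup.out_eq']
    have : Finite (commutatorSet G) := by
      refine Set.Finite.subset (Set.finite_range
        fun p : (G ⧸ center G) × (G ⧸ center G) ↦ ⁅p.1.out, p.2.out⁆) ?_
      rintro _ ⟨a, b, rfl⟩
      refine ⟨(a, b), ?_⟩
      obtain ⟨z, hz, ha⟩ := hout a
      obtain ⟨w, hw, hb⟩ := hout b
      rw [mem_center_iff] at hz hw
      have hcomm (x y : G) : ⁅x * z, y * w⁆ = ⁅x, y⁆ := by
        have hxy : x * z * (y * w) = x * y * (z * w) := by
          rw [mul_assoc x, ← mul_assoc z, ← hz y]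
          group
        have hyx : y * w * (x * z) = y * x * (z * w) := by
          rw [mul_assoc y, ← mul_assoc w, ← hw x, mul_assoc x, ← hz w]
          group
        have hdiv (u v : G) : ⁅u, v⁆ = u * v * (v * u)⁻¹ := by
          rw [commutatorElement_def]
          group
        rw [hdiv, hdiv, hxy, hyx]
        group
      conv_rhs => rw [ha, hb, hcomm]
    have : Finite (_root_.commutator G) := inferInstance
    have : Finite (G ⧸ _root_.commutator G) := h
    exact Finite.of_subgroup_quotient (_root_.commutator G)

/-- A finitely generated abelian group that is `p`-divisible for some prime `p` is finite. -/
theorem finite_of_range_powMonoidHom_eq_top (A : Type*) [CommGroup A] [Group.FG A] {p : ℕ}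
    (hp : p.Prime) (h : (powMonoidHom (α := A) p).range = ⊤) : Finite A := by
  have : AddGroup.FG (Additive A) := inferInstance
  have hfin : Module.Finite ℤ (Additive A) := Module.Finite.iff_addGroup_fg.mpr this
  obtain ⟨r, hr, hrA⟩ := Submodule.exists_sub_one_mem_and_smul_eq_zero_of_fg_of_le_smul
    (Ideal.span {(p : ℤ)}) (⊤ : Submodule ℤ (Additive A)) hfin.fg_top (by
      intro x _
      obtain ⟨y, hy⟩ : x.toMul ∈ (powMonoidHom (α := A) p).range := h ▸ mem_top _
      have : x = (p : ℤ) • Additive.ofMul y := by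
        rw [natCast_zsmul, ← ofMul_pow]
        exact hy.symm
      rw [this]
      exact Submodule.smul_mem_smul (Ideal.mem_span_singleton_self _) trivial)
  have hr0 : r ≠ 0 := by
    rintro rfl
    rw [Ideal.mem_span_singleton, zero_sub, dvd_neg] at hr
    exact hp.one_lt.ne' (by exact_mod_cast Int.eq_one_of_dvd_one (by positivity) hr)
  refine CommGroup.finite_of_fg_isMulTorsion _ fun x ↦ ?_
  rw [isOfFinOrder_iff_zpow_eq_one]
  exact ⟨r, hr0, hrA (Additive.ofMul x) trivial⟩

/-- An infinite finitely generated nilpotent group has, for each prime `p`, a proper characteristic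
subgroup of finite index containing all `p`-th powers. -/
theorem exists_characteristic_finiteIndex_pow_mem (N : Type*) [Group N] [Group.FG N] [Infinite N]
    [Group.IsNilpotent N] {p : ℕ} (hp : p.Prime) :
    ∃ K : Subgroup N, K.Characteristic ∧ K.FiniteIndex ∧ K ≠ ⊤ ∧ ∀ x, x ^ p ∈ K := by
  have hfg : Group.FG (Abelianization N) :=
    Group.fg_of_surjective (f := Abelianization.of) QuotientGroup.mk_surjective
  have := finiteIndex_range_powMonoidHom_of_fg (Abelianization N) hp.ne_zero
  refine ⟨(powMonoidHom (α := Abelianization N) p).range.comap Abelianization.of,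
    ?_, ⟨?_⟩, fun h ↦ ?_, fun x ↦ ⟨Abelianization.of x, by simp⟩⟩
  · rw [characteristic_iff_le_comap]
    rintro φ x ⟨y, hy⟩
    refine ⟨Abelianization.map φ.toMonoidHom y, ?_⟩
    rw [powMonoidHom_apply] at hy ⊢
    rw [← map_pow, hy, Abelianization.map_of]
  · rw [index_comap_of_surjective _ QuotientGroup.mk_surjective]
    exact FiniteIndex.index_ne_zero
  · refine not_finite_iff_infinite.mpr ‹Infinite N› (finite_of_finite_abelianization N
      (finite_of_range_powMonoidHom_eq_top _ hp (eq_top_iff.mpr fun y _ ↦ ?_)))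
    obtain ⟨x, rfl⟩ := QuotientGroup.mk_surjective y
    exact (h ▸ mem_top x : x ∈ comap _ _)

/-- Let `N` be an infinite nilpotent normal subgroup of finite index prime to `p` in a finitely
generated group `G`. Then `N` has a proper supplement in `G` that contains a normal subgroup of `G`
containing the `p`-th powers of elements of `N`. -/
theorem exists_supplement {G : Type*} [Group G] [Group.FG G] (N : Subgroup G) [N.Normal]
    [N.FiniteIndex] [Infinite N] [Group.IsNilpotent N] {p : ℕ} (hp : p.Prime)
    (hpN : ¬ p ∣ N.index) :
    ∃ H M : Subgroup G, M.Normal ∧ M ≤ H ∧ M ≤ N ∧ H ≠ ⊤ ∧ H ⊔ N = ⊤ ∧ ∀ x ∈ N, x ^ p ∈ M := by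
  obtain ⟨K, hKchar, hKfin, hKtop, hKpow⟩ := exists_characteristic_finiteIndex_pow_mem N hp
  set M : Subgroup G := K.map N.subtype with hM
  have hMN : M ≤ N := map_subtype_le K
  have hMpow (x : G) (hx : x ∈ N) : x ^ p ∈ M := ⟨⟨x, hx⟩ ^ p, hKpow _, rfl⟩
  have hMfin : M.FiniteIndex := by
    refine ⟨?_⟩
    rw [hM, index_map_subtype]
    exact mul_ne_zero hKfin.index_ne_zero FiniteIndex.index_ne_zero
  have hfinQ : Finite (G ⧸ M) := inferInstance
  have hpgroup : IsPGroup p (N.map (QuotientGroup.mk' M)) := by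
    rintro ⟨_, x, hx, rfl⟩
    refine ⟨1, Subtype.ext ?_⟩
    simpa [← QuotientGroup.mk_pow] using hMpow x hx
  have : Fact p.Prime := ⟨hp⟩
  obtain ⟨n, hn⟩ := IsPGroup.iff_card.mp hpgroup
  have hindex : (N.map (QuotientGroup.mk' M)).index = N.index :=
    index_map_eq _ (QuotientGroup.mk'_surjective M) (by simpa using hMN)
  obtain ⟨L, hL⟩ := exists_right_complement'_of_coprime (N := N.map (QuotientGroup.mk' M)) (by
    rw [hn, hindex]
    exact Nat.Coprime.pow_left n ((Nat.Prime.coprime_iff_not_dvd hp).mpr hpN))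
  refine ⟨L.comap (QuotientGroup.mk' M), M, inferInstance, fun x hx ↦ ?_, hMN, fun h ↦ hKtop ?_,
    eq_top_iff.mpr fun g _ ↦ ?_, hMpow⟩
  · rw [mem_comap, QuotientGroup.mk'_apply, (QuotientGroup.eq_one_iff x).mpr hx]
    exact one_mem L
  · rw [eq_top_iff]
    intro x _
    have hxL : QuotientGroup.mk' M (x : G) ∈ L := (h ▸ mem_top (x : G) : (x : G) ∈ comap _ L)
    have hx1 := disjoint_def.mp hL.disjoint (mem_map_of_mem _ x.2) hxL
    rw [QuotientGroup.mk'_apply, QuotientGroup.eq_one_iff] at hx1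
    obtain ⟨y, hy, hyx⟩ := hx1
    rwa [← Subtype.ext hyx]
  · obtain ⟨⟨⟨_, n, hn, rfl⟩, l⟩, hnl⟩ := hL.2 (QuotientGroup.mk' M g)
    have hl : n⁻¹ * g ∈ L.comap (QuotientGroup.mk' M) := by
      rw [mem_comap, map_mul, ← hnl]
      simp
    have := mul_mem (mem_sup_right hn) (mem_sup_left hl :
      n⁻¹ * g ∈ L.comap (QuotientGroup.mk' M) ⊔ N)
    simpa using this

/-- A finitely generated infinite group with a nilpotent normal subgroup of finite index is
nilpotent if all of its proper subgroups are. -/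
theorem isNilpotent_of_forall_ne_top {G : Type*} [Group G] [Group.FG G] (N : Subgroup G) [N.Normal]
    [N.FiniteIndex] [Infinite N] [Group.IsNilpotent N]
    (hG : ∀ H : Subgroup G, H ≠ ⊤ → Group.IsNilpotent H) : Group.IsNilpotent G := by
  have hlarge (m : ℕ) : ∃ p, m < p ∧ p.Prime ∧ ¬ p ∣ N.index := by
    obtain ⟨p, hle, hp⟩ := Nat.exists_infinite_primes (m + N.index + 1)
    refine ⟨p, by omega, hp, fun hd ↦ ?_⟩
    have := Nat.le_of_dvd (Nat.pos_of_ne_zero FiniteIndex.index_ne_zero) hd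
    omega
  have hpow {p : ℕ} (hp : p.Prime) (hpN : ¬ p ∣ N.index) :
      ∃ H : Subgroup G, H ≠ ⊤ ∧ H ⊔ N = ⊤ ∧ ∃ k, ∀ x ∈ N, x ^ p ∈ Subgroup.upperCentralSeries G k := by
    obtain ⟨H, M, hMn, hMH, hMN, hH, hHN, hM⟩ := exists_supplement N hp hpN
    have := hG H hH
    obtain ⟨k, hk⟩ := exists_le_upperCentralSeries hHN hMH hMN
    exact ⟨H, hH, hHN, k, fun x hx ↦ hk (hM x hx)⟩
  obtain ⟨p, -, hp, hpN⟩ := hlarge 0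
  obtain ⟨q, hpq, hq, hqN⟩ := hlarge p
  obtain ⟨H, hH, hHN, k, hk⟩ := hpow hp hpN
  obtain ⟨-, -, -, l, hl⟩ := hpow hq hqN
  have hcop : IsCoprime (p : ℤ) q :=
    Nat.isCoprime_iff_coprime.mpr ((Nat.coprime_primes hp hq).mpr hpq.ne)
  have hN : N ≤ Subgroup.upperCentralSeries G (k + l) := by
    intro x hx
    obtain ⟨a, b, hab⟩ := hcop
    rw [← zpow_one x, ← hab, zpow_add, mul_comm a, mul_comm b, zpow_mul, zpow_mul, zpow_natCast,
      zpow_natCast]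
    exact mul_mem (zpow_mem (Subgroup.upperCentralSeries_mono _ (Nat.le_add_right k l) (hk x hx)) a)
      (zpow_mem (Subgroup.upperCentralSeries_mono _ (Nat.le_add_left l k) (hl x hx)) b)
  obtain ⟨d, hd⟩ := (hG H hH).nilpotent
  refine ⟨k + l + d, eq_top_iff.mpr (hHN ▸ sup_le (fun x hx ↦ ?_)
    (hN.trans (Subgroup.upperCentralSeries_mono _ (Nat.le_add_right _ d))))⟩
  refine mem_upperCentralSeries_add_of_sup_eq_top (X := ⊤) hHN (fun y _ n hn ↦ ?_) d ⟨x, hx⟩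
    (hd ▸ mem_top _) (mem_top _)
  have := mul_mem (Normal.conj_mem inferInstance n (hN hn) y) (inv_mem (hN hn))
  simpa [commutatorElement_def] using this

/-- A finitely generated minimal non-nilpotent group with a proper subgroup of finite
index is finite; in particular, every locally graded finitely generated minimal
non-nilpotent group is finite. -/
theorem stmt_9 {G : Type*} [Group G] (hfg : Group.FG G) (hmin : MinimalNonNilpotent G) :
    ((∃ H : Subgroup G, H ≠ ⊤ ∧ H.FiniteIndex) → Finite G) ∧
    (LocallyGraded G → Finite G) := by
  have hfinite : (∃ H : Subgroup G, H ≠ ⊤ ∧ H.FiniteIndex) → Finite G := by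
    rintro ⟨H, hH, hHfin⟩
    by_contra hinf
    have hNtop : H.normalCore ≠ ⊤ := fun h ↦ hH (eq_top_iff.mpr (h ▸ H.normalCore_le))
    have : Group.IsNilpotent H.normalCore := hmin.2 _ hNtop
    have : Infinite H.normalCore := by
      refine not_finite_iff_infinite.mp fun hfin ↦ hinf ?_
      exact Finite.of_subgroup_quotient H.normalCore
    exact hmin.1 (isNilpotent_of_forall_ne_top H.normalCore hmin.2)
  refine ⟨hfinite, fun hlg ↦ hfinite ?_⟩
  have htop : (⊤ : Subgroup G) ≠ ⊥ := by
    intro h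
    have : Subsingleton G := Subgroup.subsingleton_iff.mp (subsingleton_of_bot_eq_top h.symm)
    exact hmin.1 inferInstance
  obtain ⟨K, hK, hKfin⟩ := hlg ⊤ htop ((Group.fg_iff_subgroup_fg ⊤).mpr (Group.fg_def.mp hfg))
  refine ⟨K.map (⊤ : Subgroup G).subtype, fun h ↦ hK (eq_top_iff.mpr fun x _ ↦ ?_), ⟨?_⟩⟩
  · obtain ⟨y, hy, hyx⟩ := eq_top_iff.mp h (mem_top (x : G))
    rwa [← Subtype.ext hyx]
  · rw [index_map_subtype]
    exact mul_ne_zero hKfin.index_ne_zero (by simp)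
end

section
/- Let G be a para-Nil-Hamiltonian group. Suppose G has a finitely generated minimal non-nilpotent subgroup X whose normal closure X^G is locally graded. Then the commutator subgroup G' of G is finite. Furthermore, if in addition either X is normal in G or G is infinite, then G is soluble. -/
open scoped commutatorElement

section Dedekind

variable {G : Type*} [Group G]

/-- In a group of class at most two, `x ↦ ⁅x, b⁆` is a homomorphism. -/
def commutatorHomLeft (hc : ∀ a b : G, ⁅a, b⁆ ∈ Subgroup.center G) (b : G) : G →* G where
  toFun x := ⁅x, b⁆
  map_one' := commutatorElement_one_left b
  map_mul' x y := by
    have h := Subgroup.mem_center_iff.1 (hc y b) x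
    calc ⁅x * y, b⁆ = x * ⁅y, b⁆ * b * x⁻¹ * b⁻¹ := by simp only [commutatorElement_def]; group
      _ = ⁅y, b⁆ * ⁅x, b⁆ := by rw [h]; simp only [commutatorElement_def]; group
      _ = ⁅x, b⁆ * ⁅y, b⁆ := (Subgroup.mem_center_iff.1 (hc y b) _).symm

theorem commutatorElement_mul_left_of_class_two (hc : ∀ a b : G, ⁅a, b⁆ ∈ Subgroup.center G)
    (x y b : G) : ⁅x * y, b⁆ = ⁅x, b⁆ * ⁅y, b⁆ :=
  map_mul (commutatorHomLeft hc b) x y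

theorem commutatorElement_zpow_left_of_class_two (hc : ∀ a b : G, ⁅a, b⁆ ∈ Subgroup.center G)
    (x b : G) (k : ℤ) : ⁅x ^ k, b⁆ = ⁅x, b⁆ ^ k :=
  map_zpow (commutatorHomLeft hc b) x k

theorem commutatorElement_pow_left_of_class_two (hc : ∀ a b : G, ⁅a, b⁆ ∈ Subgroup.center G)
    (x b : G) (k : ℕ) : ⁅x ^ k, b⁆ = ⁅x, b⁆ ^ k :=
  map_pow (commutatorHomLeft hc b) x k

theorem commutatorElement_mul_right_of_class_two (hc : ∀ a b : G, ⁅a, b⁆ ∈ Subgroup.center G)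
    (x y b : G) : ⁅b, x * y⁆ = ⁅b, x⁆ * ⁅b, y⁆ := by
  rw [← commutatorElement_inv, commutatorElement_mul_left_of_class_two hc, mul_inv_rev,
    commutatorElement_inv, commutatorElement_inv]
  exact Subgroup.mem_center_iff.1 (hc b x) _

theorem commutatorElement_pow_right_of_class_two (hc : ∀ a b : G, ⁅a, b⁆ ∈ Subgroup.center G)
    (x b : G) (k : ℕ) : ⁅b, x ^ k⁆ = ⁅b, x⁆ ^ k := by
  rw [← commutatorElement_inv, commutatorElement_pow_left_of_class_two hc, ← inv_pow,
    commutatorElement_inv]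

theorem mul_pow_of_class_two (hc : ∀ a b : G, ⁅a, b⁆ ∈ Subgroup.center G) (x y : G) (k : ℕ) :
    (x * y) ^ k = x ^ k * y ^ k * ⁅y, x⁆ ^ (k * (k - 1) / 2) := by
  rw [← Nat.choose_two_right]
  have hz := fun (n : ℕ) (g : G) =>
    Subgroup.mem_center_iff.1 ((Subgroup.center G).pow_mem (hc y x) n) g
  induction k with
  | zero => simp
  | succ k ih =>
    have h : y ^ k * x = x * y ^ k * ⁅y, x⁆ ^ k := by
      rw [hz, ← commutatorElement_pow_left_of_class_two hc, commutatorElement_def]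
      group
    calc (x * y) ^ (k + 1) = x ^ k * y ^ k * (⁅y, x⁆ ^ k.choose 2 * (x * y)) := by
          rw [pow_succ, ih, mul_assoc]
      _ = x ^ k * (y ^ k * x) * y * ⁅y, x⁆ ^ k.choose 2 := by
          rw [← hz]; simp only [mul_assoc]
      _ = x ^ k * x * y ^ k * (⁅y, x⁆ ^ k * y) * ⁅y, x⁆ ^ k.choose 2 := by
          rw [h]; simp only [mul_assoc]
      _ = x ^ (k + 1) * y ^ (k + 1) * (⁅y, x⁆ ^ k * ⁅y, x⁆ ^ k.choose 2) := by
          rw [← hz, pow_succ, pow_succ]; simp only [mul_assoc]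
      _ = _ := by
          rw [← pow_add, Nat.choose_succ_succ' k 1, Nat.choose_one_right]

theorem conj_mem_zpowers_of_forall_normal (hD : ∀ H : Subgroup G, H.Normal)
    (a b : G) : b * a * b⁻¹ ∈ Subgroup.zpowers a :=
  (hD _).conj_mem a (Subgroup.mem_zpowers a) b

theorem commutatorElement_mem_zpowers_left (hD : ∀ H : Subgroup G, H.Normal)
    (a b : G) : ⁅a, b⁆ ∈ Subgroup.zpowers a := by
  rw [commutatorElement_def, mul_assoc, mul_assoc, ← mul_assoc b]
  refine mul_mem (Subgroup.mem_zpowers a) ?_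
  exact (hD _).conj_mem _ (inv_mem (Subgroup.mem_zpowers a)) b

theorem commutatorElement_mem_zpowers_right (hD : ∀ H : Subgroup G, H.Normal)
    (a b : G) : ⁅a, b⁆ ∈ Subgroup.zpowers b := by
  rw [← commutatorElement_inv]
  exact inv_mem (commutatorElement_mem_zpowers_left hD b a)

theorem commutatorElement_mem_center_of_forall_normal (hD : ∀ H : Subgroup G, H.Normal)
    (a b : G) :
    ⁅a, b⁆ ∈ Subgroup.center G := by
  rw [Subgroup.mem_center_iff]
  intro x
  obtain ⟨i, hi⟩ := Subgroup.mem_zpowers_iff.1 (conj_mem_zpowers_of_forall_normal hD x a⁻¹)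
  obtain ⟨j, hj⟩ := Subgroup.mem_zpowers_iff.1 (conj_mem_zpowers_of_forall_normal hD x b⁻¹)
  have h1 : a⁻¹ * b⁻¹ * x * b * a = x ^ (i * j) := by
    calc _ = a⁻¹ * (b⁻¹ * x * b⁻¹⁻¹) * a⁻¹⁻¹ := by group
      _ = (a⁻¹ * x * a⁻¹⁻¹) ^ j := by rw [← hj, conj_zpow]
      _ = _ := by rw [← hi, zpow_mul]
  have h2 : b⁻¹ * a⁻¹ * x * a * b = x ^ (i * j) := by
    calc _ = b⁻¹ * (a⁻¹ * x * a⁻¹⁻¹) * b⁻¹⁻¹ := by group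
      _ = (b⁻¹ * x * b⁻¹⁻¹) ^ i := by rw [← hi, conj_zpow]
      _ = _ := by rw [← hj, mul_comm i, zpow_mul]
  calc x * ⁅a, b⁆ = a * b * (b⁻¹ * a⁻¹ * x * a * b) * a⁻¹ * b⁻¹ := by
        rw [commutatorElement_def]; group
    _ = ⁅a, b⁆ * x := by rw [h2, ← h1, commutatorElement_def]; group

theorem isOfFinOrder_left_of_commutatorElement_ne_one (hD : ∀ H : Subgroup G, H.Normal) {a b : G}
    (h : ⁅a, b⁆ ≠ 1) : IsOfFinOrder a := by
  have hc := commutatorElement_mem_center_of_forall_normal hD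
  obtain ⟨k, hk⟩ := Subgroup.mem_zpowers_iff.1 (commutatorElement_mem_zpowers_left hD a b)
  have h1 : ⁅a, b⁆ ^ k = 1 := by
    rw [← commutatorElement_zpow_left_of_class_two hc, hk, commutatorElement_eq_one_iff_mul_comm]
    exact (Subgroup.mem_center_iff.1 (hc a b) b).symm
  rw [isOfFinOrder_iff_zpow_eq_one]
  refine ⟨k * k, ?_, by rw [zpow_mul, hk, h1]⟩
  rintro h0
  rw [mul_self_eq_zero] at h0
  rw [h0, zpow_zero] at hk
  exact h hk.symm

theorem isOfFinOrder_right_of_commutatorElement_ne_one (hD : ∀ H : Subgroup G, H.Normal) {a b : G}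
    (h : ⁅a, b⁆ ≠ 1) : IsOfFinOrder b := by
  refine isOfFinOrder_left_of_commutatorElement_ne_one hD (b := a) ?_
  rwa [← commutatorElement_inv, ne_eq, inv_eq_one]

theorem zpowers_eq_zpowers_pow_of_orderOf_prime_pow {p n : ℕ} (hp : p.Prime) {x c : G}
    (hx : orderOf x = p ^ (n + 1)) (hc : orderOf c = p) (hcx : c ∈ Subgroup.zpowers x) :
    Subgroup.zpowers c = Subgroup.zpowers (x ^ p ^ n) := by
  have hox : orderOf (x ^ p ^ n) = p := by
    rw [orderOf_pow_of_dvd (pow_ne_zero _ hp.ne_zero) (hx ▸ pow_dvd_pow p n.le_succ), hx, pow_succ,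
      Nat.mul_div_cancel_left _ (pow_pos hp.pos n)]
  obtain ⟨k, rfl⟩ := Subgroup.mem_zpowers_iff.1 hcx
  have hle : Subgroup.zpowers (x ^ k) ≤ Subgroup.zpowers (x ^ p ^ n) := by
    rw [Subgroup.zpowers_le]
    have h1 : x ^ (k * p) = 1 := by
      rw [zpow_mul, zpow_natCast]
      exact orderOf_dvd_iff_pow_eq_one.1 hc.dvd
    rw [← orderOf_dvd_iff_zpow_eq_one, hx, pow_succ, Nat.cast_mul] at h1
    obtain ⟨v, rfl⟩ := Int.dvd_of_mul_dvd_mul_right (by exact_mod_cast hp.ne_zero) h1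
    rw [zpow_mul, zpow_natCast]
    exact Subgroup.zpow_mem_zpowers _ _
  have : Finite (Subgroup.zpowers (x ^ p ^ n)) :=
    finite_zpowers.2 (orderOf_pos_iff.1 (hox.symm ▸ hp.pos))
  exact Subgroup.eq_of_le_of_card_ge hle (by rw [Nat.card_zpowers, Nat.card_zpowers, hc, hox])

theorem sq_eq_of_orderOf_eq_two_of_orderOf_eq_four {x c : G} (hx : orderOf x = 4)
    (hc : orderOf c = 2) (hcx : c ∈ Subgroup.zpowers x) : x ^ 2 = c := by
  have h := zpowers_eq_zpowers_pow_of_orderOf_prime_pow (n := 1) Nat.prime_two hx hc hcx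
  have h2 : c ^ 2 = 1 := hc ▸ pow_orderOf_eq_one c
  have hx2 : x ^ 2 ∈ Subgroup.zpowers c := by
    rw [h, pow_one]; exact Subgroup.mem_zpowers _
  obtain ⟨k, hk⟩ := Subgroup.mem_zpowers_iff.1 hx2
  obtain ⟨j, rfl | rfl⟩ := Int.even_or_odd' k
  · rw [zpow_mul, zpow_ofNat, h2, one_zpow] at hk
    have := orderOf_dvd_of_pow_eq_one hk.symm
    rw [hx] at this
    omega
  · rw [zpow_add, zpow_mul, zpow_ofNat, h2, one_zpow, one_mul, zpow_one] at hk
    exact hk.symm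

theorem orderOf_eq_prime_pow_succ_of_forall_pow_eq_one {x c : G} {p : ℕ} (hx : IsOfFinOrder x)
    (hx1 : x ≠ 1) (hc : orderOf c = p) (hp : p.Prime)
    (h : ∀ q : ℕ, q.Prime → q ∣ orderOf x → c ^ q = 1) :
    ∃ n, orderOf x = p ^ (n + 1) := by
  have h1 := Nat.eq_prime_pow_of_unique_prime_dvd (n := orderOf x) (p := p)
    hx.orderOf_pos.ne' fun {q} hq hqx =>
      ((Nat.prime_dvd_prime_iff_eq hp hq).1 (hc ▸ orderOf_dvd_of_pow_eq_one (h q hq hqx))).symm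
  obtain hn | ⟨n, hn⟩ := (orderOf x).primeFactorsList.length.eq_zero_or_eq_succ_pred.imp_right
    (fun h => (⟨_, h⟩ : ∃ n, (orderOf x).primeFactorsList.length = n + 1))
  · rw [hn, pow_zero, orderOf_eq_one_iff] at h1
    exact absurd h1 hx1
  · exact ⟨n, by rw [← hn]; exact h1⟩

theorem orderOf_pow_lt_of_prime_dvd {x : G} {q : ℕ} (hx : IsOfFinOrder x) (hq : q.Prime)
    (hqx : q ∣ orderOf x) : orderOf (x ^ q) < orderOf x := by
  rw [orderOf_pow_of_dvd hq.ne_zero hqx]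
  exact Nat.div_lt_self hx.orderOf_pos hq.one_lt

theorem Nat.Prime.eq_two_and_eq_one_of_not_dvd_pow_mul_pred_div_two {p n : ℕ} (hp : p.Prime)
    (h : ¬ p ∣ p ^ n * (p ^ n - 1) / 2) : p = 2 ∧ n = 1 := by
  obtain _ | n := n
  · simp at h
  obtain rfl | hodd := hp.eq_two_or_odd'
  · refine ⟨rfl, ?_⟩
    obtain _ | n := n
    · rfl
    · refine absurd ?_ h
      rw [pow_succ, mul_right_comm, Nat.mul_div_cancel _ two_pos, pow_succ, mul_right_comm]
      exact Dvd.intro_left _ rfl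
  · refine absurd ?_ h
    have h2 : 2 ∣ p ^ (n + 1) - 1 := (Nat.Odd.sub_odd (hodd.pow) odd_one).two_dvd
    rw [Nat.mul_div_assoc _ h2, pow_succ, mul_right_comm]
    exact Dvd.intro_left _ rfl

/-- A nonabelian group all of whose subgroups are normal contains a quaternion pair. -/
theorem exists_quaternion_pair_of_forall_normal (hD : ∀ H : Subgroup G, H.Normal)
    (hne : ∃ a b : G, ⁅a, b⁆ ≠ 1) :
    ∃ a b : G, ⁅a, b⁆ ≠ 1 ∧ ⁅a, b⁆ ^ 2 = 1 ∧ a ^ 2 = ⁅a, b⁆ ∧ b ^ 2 = ⁅a, b⁆ := by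
  classical
  have hcen := commutatorElement_mem_center_of_forall_normal hD
  have hP : ∃ n, ∃ a b : G, ⁅a, b⁆ ≠ 1 ∧ orderOf b = n := by
    obtain ⟨a, b, h⟩ := hne
    exact ⟨_, a, b, h, rfl⟩
  obtain ⟨a₀, b, hab₀, hbn⟩ := Nat.find_spec hP
  have hb : ∀ x y : G, ⁅x, y⁆ ≠ 1 → orderOf b ≤ orderOf y := fun x y hxy => by
    rw [hbn]; exact Nat.find_min' hP ⟨x, y, hxy, rfl⟩
  have hQ : ∃ n, ∃ a : G, ⁅a, b⁆ ≠ 1 ∧ orderOf a = n := ⟨_, a₀, hab₀, rfl⟩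
  obtain ⟨a, hab, han⟩ := Nat.find_spec hQ
  have ha : ∀ x : G, ⁅x, b⁆ ≠ 1 → orderOf a ≤ orderOf x := fun x hx => by
    rw [han]; exact Nat.find_min' hQ ⟨x, hx, rfl⟩
  have hafin := isOfFinOrder_left_of_commutatorElement_ne_one hD hab
  have hbfin := isOfFinOrder_right_of_commutatorElement_ne_one hD hab
  have hb1 : b ≠ 1 := by rintro rfl; simp at hab
  have ha1 : a ≠ 1 := by rintro rfl; simp at hab
  have hbq : ∀ q : ℕ, q.Prime → q ∣ orderOf b → ⁅a, b⁆ ^ q = 1 := fun q hq hqb => by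
    rw [← commutatorElement_pow_right_of_class_two hcen]
    by_contra h
    exact (hb _ _ h).not_gt (orderOf_pow_lt_of_prime_dvd hbfin hq hqb)
  have haq : ∀ q : ℕ, q.Prime → q ∣ orderOf a → ⁅a, b⁆ ^ q = 1 := fun q hq hqa => by
    rw [← commutatorElement_pow_left_of_class_two hcen]
    by_contra h
    exact (ha _ h).not_gt (orderOf_pow_lt_of_prime_dvd hafin hq hqa)
  have hob1 : orderOf b ≠ 1 := fun h => hb1 (orderOf_eq_one_iff.1 h)
  obtain ⟨p, hp, hpb⟩ := Nat.exists_prime_and_dvd hob1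
  have : Fact p.Prime := ⟨hp⟩
  have hoc : orderOf ⁅a, b⁆ = p := orderOf_eq_prime (hbq p hp hpb) hab
  obtain ⟨n, hn⟩ := orderOf_eq_prime_pow_succ_of_forall_pow_eq_one hbfin hb1 hoc hp hbq
  obtain ⟨m, hm⟩ := orderOf_eq_prime_pow_succ_of_forall_pow_eq_one hafin ha1 hoc hp haq
  have hnm : n ≤ m := by
    have h := hb b a (by rwa [← commutatorElement_inv, ne_eq, inv_eq_one])
    rw [hn, hm, Nat.pow_le_pow_iff_right hp.one_lt] at h
    omega
  have hzb := zpowers_eq_zpowers_pow_of_orderOf_prime_pow hp hn hoc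
    (commutatorElement_mem_zpowers_right hD a b)
  have hza := zpowers_eq_zpowers_pow_of_orderOf_prime_pow hp hm hoc
    (commutatorElement_mem_zpowers_left hD a b)
  obtain ⟨w, hw⟩ : b ^ p ^ n ∈ Subgroup.zpowers (a ^ p ^ m) := by
    rw [← hza, hzb]; exact Subgroup.mem_zpowers _
  simp only at hw
  obtain ⟨k, hk⟩ : ∃ k : ℤ, k = (p ^ (m - n) : ℕ) * w := ⟨_, rfl⟩
  have hgb : (a ^ k) ^ p ^ n = b ^ p ^ n := by
    rw [← hw, ← zpow_natCast, ← zpow_natCast, ← zpow_mul, ← zpow_mul]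
    congr 1
    rw [hk, mul_right_comm, ← Nat.cast_mul, ← pow_add, Nat.sub_add_cancel hnm]
  have hcomm : ⁅a, (a ^ k)⁻¹ * b⁆ = ⁅a, b⁆ := by
    rw [commutatorElement_mul_right_of_class_two hcen, (commutatorElement_eq_one_iff_commute
      (g₁ := a) (g₂ := (a ^ k)⁻¹)).2 ((Commute.refl a).zpow_right k).inv_right, one_mul]
  have hd := hb a ((a ^ k)⁻¹ * b) (by rwa [hcomm])
  have he : ⁅b, (a ^ k)⁻¹⁆ = ⁅a, b⁆ ^ k := by
    rw [← commutatorElement_inv, ← zpow_neg, commutatorElement_zpow_left_of_class_two hcen,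
      ← zpow_neg, neg_neg]
  have hpow : ((a ^ k)⁻¹ * b) ^ p ^ n = ⁅a, b⁆ ^ (k * (p ^ n * (p ^ n - 1) / 2 : ℕ)) := by
    rw [mul_pow_of_class_two hcen, he, inv_pow, hgb, inv_mul_cancel, one_mul, zpow_mul,
      zpow_natCast]
  have hndvd : ¬ (p : ℤ) ∣ k * (p ^ n * (p ^ n - 1) / 2 : ℕ) := by
    intro h
    replace h := orderOf_dvd_iff_zpow_eq_one.1 ((Int.natCast_dvd_natCast.2 hoc.dvd).trans h)
    rw [← hpow] at h
    have h1 := hd.trans (Nat.le_of_dvd (pow_pos hp.pos n) (orderOf_dvd_of_pow_eq_one h))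
    rw [hn, Nat.pow_le_pow_iff_right hp.one_lt] at h1
    omega
  obtain ⟨hp2, hn1⟩ := hp.eq_two_and_eq_one_of_not_dvd_pow_mul_pred_div_two (n := n) fun h =>
    hndvd (Dvd.dvd.mul_left (Int.natCast_dvd_natCast.2 h) _)
  have hmn : m = n := by
    by_contra hne
    rw [hk] at hndvd
    refine hndvd (Dvd.dvd.mul_right (Dvd.dvd.mul_right (Int.natCast_dvd_natCast.2 ?_) _) _)
    exact dvd_pow_self p (by omega)
  subst hmn hp2 hn1
  exact ⟨a, b, hab, hoc ▸ pow_orderOf_eq_one _,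
    sq_eq_of_orderOf_eq_two_of_orderOf_eq_four hm hoc (commutatorElement_mem_zpowers_left hD a b),
    sq_eq_of_orderOf_eq_two_of_orderOf_eq_four hn hoc (commutatorElement_mem_zpowers_right hD a b)⟩

theorem Subgroup.normal_of_forall_normal (hD : ∀ H : Subgroup G, H.Normal) (C : Subgroup G)
    (H : Subgroup C) : H.Normal := by
  have := (hD (H.map C.subtype)).comap C.subtype
  rwa [Subgroup.comap_map_eq_self_of_injective C.subtype_injective] at this

theorem commute_of_commute_quaternion_pair (hD : ∀ H : Subgroup G, H.Normal) {a b x y : G}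
    (hab : ⁅a, b⁆ ≠ 1) (hab2 : ⁅a, b⁆ ^ 2 = 1) (ha : a ^ 2 = ⁅a, b⁆)
    (hxa : Commute x a) (hxb : Commute x b) (hya : Commute y a) (hyb : Commute y b) :
    Commute x y := by
  have hcen := commutatorElement_mem_center_of_forall_normal hD
  by_contra hxy
  let C := Subgroup.centralizer ({a, b} : Set G)
  have hC : ∀ z : G, z ∈ C ↔ Commute z a ∧ Commute z b := fun z => by
    simp only [C, Subgroup.mem_centralizer_iff, Set.mem_insert_iff, Set.mem_singleton_iff,
      forall_eq_or_imp, forall_eq]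
    exact and_congr eq_comm eq_comm
  obtain ⟨⟨x, hx⟩, ⟨y, hy⟩, h1, h2, h3, -⟩ := exists_quaternion_pair_of_forall_normal
    (Subgroup.normal_of_forall_normal hD C)
    ⟨⟨x, (hC x).2 ⟨hxa, hxb⟩⟩, ⟨y, (hC y).2 ⟨hya, hyb⟩⟩, fun h => hxy <| by
      rw [commutatorElement_eq_one_iff_commute] at h
      exact congrArg Subtype.val h⟩
  replace h1 : ⁅x, y⁆ ≠ 1 := fun h => h1 (Subtype.ext h)
  replace h2 : ⁅x, y⁆ ^ 2 = 1 := congrArg Subtype.val h2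
  replace h3 : x ^ 2 = ⁅x, y⁆ := congrArg Subtype.val h3
  rw [hC] at hx
  have hax : ⁅a * x, b⁆ = ⁅a, b⁆ := by
    rw [commutatorElement_mul_left_of_class_two hcen,
      commutatorElement_eq_one_iff_commute.2 hx.2, mul_one]
  have hsq : (a * x) ^ 2 = ⁅a, b⁆ * ⁅x, y⁆ := by
    rw [hx.1.symm.mul_pow, ha, h3]
  have hsq2 : (⁅a, b⁆ * ⁅x, y⁆) ^ 2 = 1 := by
    rw [(Commute.mul_pow (Subgroup.mem_center_iff.1 (hcen x y) _)), hab2, h2, one_mul]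
  obtain ⟨k, hk⟩ := Subgroup.mem_zpowers_iff.1 (commutatorElement_mem_zpowers_left hD (a * x) b)
  rw [hax] at hk
  obtain ⟨j, rfl | rfl⟩ := Int.even_or_odd' k
  · rw [zpow_mul, zpow_ofNat, hsq] at hk
    obtain ⟨i, rfl | rfl⟩ := Int.even_or_odd' j
    · rw [zpow_mul, zpow_ofNat, hsq2, one_zpow] at hk
      exact hab hk.symm
    · rw [zpow_add, zpow_mul, zpow_ofNat, hsq2, one_zpow, one_mul, zpow_one, mul_eq_left] at hk
      exact h1 hk
  · rw [zpow_add, zpow_mul, zpow_ofNat, hsq, zpow_one, ← eq_inv_mul_iff_mul_eq] at hk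
    have : a * x ∈ Subgroup.center G := by
      rw [hk]
      exact mul_mem (inv_mem (zpow_mem (mul_mem (hcen _ _) (hcen _ _)) _)) (hcen _ _)
    rw [commutatorElement_eq_one_iff_commute.2 (Subgroup.mem_center_iff.1 this b).symm] at hax
    exact hab hax.symm

theorem commutatorElement_quaternion_left_eq (hD : ∀ H : Subgroup G, H.Normal) {a b : G}
    (hab : ⁅a, b⁆ ≠ 1) (hab2 : ⁅a, b⁆ ^ 2 = 1) (ha : a ^ 2 = ⁅a, b⁆) (g : G) :
    ⁅a, g⁆ = 1 ∨ ⁅a, g⁆ = ⁅a, b⁆ := by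
  have hcen := commutatorElement_mem_center_of_forall_normal hD
  obtain ⟨k, hk⟩ := Subgroup.mem_zpowers_iff.1 (commutatorElement_mem_zpowers_left hD a g)
  obtain ⟨j, rfl | rfl⟩ := Int.even_or_odd' k
  · rw [zpow_mul, zpow_ofNat, ha] at hk
    obtain ⟨i, rfl | rfl⟩ := Int.even_or_odd' j
    · rw [zpow_mul, zpow_ofNat, hab2, one_zpow] at hk
      exact Or.inl hk.symm
    · rw [zpow_add, zpow_mul, zpow_ofNat, hab2, one_zpow, one_mul, zpow_one] at hk
      exact Or.inr hk.symm
  · rw [zpow_add, zpow_mul, zpow_ofNat, ha, zpow_one, ← eq_inv_mul_iff_mul_eq] at hk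
    have : a ∈ Subgroup.center G := by
      rw [hk]
      exact mul_mem (inv_mem (zpow_mem (hcen _ _) _)) (hcen _ _)
    exact absurd (commutatorElement_eq_one_iff_commute.2 (Subgroup.mem_center_iff.1 this b).symm)
      hab

/-- A group all of whose subgroups are normal has finitely many commutators. -/
theorem finite_commutatorSet_of_forall_normal (hD : ∀ H : Subgroup G, H.Normal) :
    Finite (commutatorSet G) := by
  have hcen := commutatorElement_mem_center_of_forall_normal hD
  by_cases hne : ∃ a b : G, ⁅a, b⁆ ≠ 1
  swap
  · push Not at hne
    refine Set.Finite.subset (Set.finite_singleton (1 : G)) ?_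
    rintro _ ⟨a, b, rfl⟩
    exact hne a b
  obtain ⟨a, b, hab, hab2, ha, hb⟩ := exists_quaternion_pair_of_forall_normal hD hne
  have hswap : ⁅b, a⁆ = ⁅a, b⁆ := by
    rw [← commutatorElement_inv, inv_eq_iff_mul_eq_one, ← sq, hab2]
  have key : ∀ g : G, ∃ u ∈ ({1, a, b, a * b} : Set G), ∃ x, g = u * x ∧ Commute x a ∧
      Commute x b := by
    intro g
    obtain ⟨s, hs, hsb, hsa⟩ : ∃ s, (s = 1 ∨ s = b) ∧ ⁅b, s⁆ = 1 ∧ ⁅a, s⁆ = ⁅a, g⁆ := by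
      rcases commutatorElement_quaternion_left_eq hD hab hab2 ha g with h | h
      · exact ⟨1, by simp [h]⟩
      · exact ⟨b, by simp [h]⟩
    obtain ⟨t, ht, hta, htb⟩ : ∃ t, (t = 1 ∨ t = a) ∧ ⁅a, t⁆ = 1 ∧ ⁅b, t⁆ = ⁅b, g⁆ := by
      rw [← hswap] at hab hab2 hb
      rcases commutatorElement_quaternion_left_eq hD hab hab2 hb g with h | h
      · exact ⟨1, by simp [h]⟩
      · exact ⟨a, by simp [h]⟩
    have hx : ∀ z : G, ⁅z, g⁆ = ⁅z, t⁆ * ⁅z, s⁆ → Commute ((t * s)⁻¹ * g) z := fun z hz => by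
      refine (commutatorElement_eq_one_iff_commute.1 ?_).symm
      have h := commutatorElement_mul_right_of_class_two hcen (t * s) ((t * s)⁻¹ * g) z
      rwa [mul_inv_cancel_left, hz, commutatorElement_mul_right_of_class_two hcen,
        left_eq_mul] at h
    refine ⟨t * s, ?_, (t * s)⁻¹ * g, (mul_inv_cancel_left _ _).symm, hx a ?_, hx b ?_⟩
    · rcases hs with rfl | rfl <;> rcases ht with rfl | rfl <;> simp
    · rw [hta, hsa, one_mul]
    · rw [htb, hsb, mul_one]
  have hfin : ({1, a, b, a * b} : Set G).Finite := by simp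
  refine (hfin.image2 (fun u v => ⁅u, v⁆) hfin).subset ?_
  rintro _ ⟨g, h, rfl⟩
  obtain ⟨u, hu, x, rfl, hxa, hxb⟩ := key g
  obtain ⟨v, hv, y, rfl, hya, hyb⟩ := key h
  refine ⟨u, hu, v, hv, ?_⟩
  have hcomm : ∀ z w : G, Commute z a → Commute z b → w ∈ ({1, a, b, a * b} : Set G) →
      Commute z w := by
    rintro z w hza hzb (rfl | rfl | rfl | rfl)
    exacts [Commute.one_right z, hza, hzb, hza.mul_right hzb]
  have h1 := commutatorElement_eq_one_iff_commute.2 (hcomm x v hxa hxb hv)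
  have h2 := commutatorElement_eq_one_iff_commute.2 (hcomm y u hya hyb hu).symm
  have h3 := commutatorElement_eq_one_iff_commute.2
    (commute_of_commute_quaternion_pair hD hab hab2 ha hxa hxb hya hyb)
  simp only [commutatorElement_mul_left_of_class_two hcen,
    commutatorElement_mul_right_of_class_two hcen, h1, h2, h3, mul_one]

theorem isSolvable_of_forall_normal (hD : ∀ H : Subgroup G, H.Normal) : Group.IsSolvable G := by
  have hcen := commutatorElement_mem_center_of_forall_normal hD
  refine (Group.isSolvable_iff_subgroup_quotient (Subgroup.center G)).2 ⟨?_, ?_⟩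
  · exact Group.isSolvable_of_comm fun a b => Subtype.ext (Subgroup.mem_center_iff.1 b.2 a)
  · refine Group.isSolvable_of_comm fun a b => ?_
    induction a using QuotientGroup.induction_on with | H a => ?_
    induction b using QuotientGroup.induction_on with | H b => ?_
    rw [← commutatorElement_eq_one_iff_mul_comm]
    exact (QuotientGroup.eq_one_iff ⁅a, b⁆).2 (hcen a b)

end Dedekind

section Schmidt

open Subgroup

variable {G : Type*} [Group G]

theorem isCoatom_map_conj {M : Subgroup G} (hM : IsCoatom M) (g : G) :
    IsCoatom (M.map (MulAut.conj g).toMonoidHom) :=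
  ((MulAut.conj g).mapSubgroup.isCoatom_iff M).2 hM

theorem mem_map_conj_iff {M : Subgroup G} {g x : G} :
    x ∈ M.map (MulAut.conj g).toMonoidHom ↔ g⁻¹ * x * g ∈ M := by
  constructor
  · rintro ⟨y, hy, rfl⟩
    simpa [mul_assoc] using hy
  · intro h
    exact ⟨_, h, by simp [mul_assoc]⟩

theorem mem_of_map_conj_eq_of_isCoatom [IsSimpleGroup G] {M : Subgroup G} (hM : IsCoatom M)
    (hbot : M ≠ ⊥) {g h : G}
    (hgh : M.map (MulAut.conj g).toMonoidHom = M.map (MulAut.conj h).toMonoidHom) :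
    g⁻¹ * h ∈ M := by
  have hN : normalizer (M : Set G) = M := by
    by_contra hne
    have htop := hM.2 _ (le_normalizer.lt_of_ne (Ne.symm hne))
    rcases (normalizer_eq_top_iff.1 htop).eq_bot_or_eq_top with h | h
    exacts [hbot h, hM.1 h]
  rw [← hN, mem_normalizer_iff]
  intro y
  have h1 := SetLike.ext_iff.1 hgh (h * y * h⁻¹)
  rw [mem_map_conj_iff, mem_map_conj_iff] at h1
  simpa [mul_assoc] using h1.symm

variable [Finite G]

theorem inf_eq_bot_of_isCoatom_of_ne_of_forall_isNilpotent [IsSimpleGroup G]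
    (hnil : ∀ H : Subgroup G, H ≠ ⊤ → Group.IsNilpotent H) {M L : Subgroup G}
    (hM : IsCoatom M) (hL : IsCoatom L) (hne : M ≠ L) : M ⊓ L = ⊥ := by
  induction h : Nat.card G - Nat.card ↥(M ⊓ L) using Nat.strong_induction_on
    generalizing M L with
  | _ n ih =>
    by_contra hbot
    have hlt : ∀ Q R : Subgroup G, IsCoatom Q → IsCoatom R → Q ≠ R → Q ⊓ R < Q :=
      fun Q R hQ hR hQR => inf_le_left.lt_of_ne fun h => hQR
        ((hQ.le_iff_eq hR.1).1 (inf_eq_left.1 h)).symm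
    have hDM := hlt M L hM hL hne
    have hDL : M ⊓ L < L := inf_comm M L ▸ hlt L M hL hM hne.symm
    have hN : normalizer ((M ⊓ L : Subgroup G) : Set G) ≠ ⊤ := fun h => by
      rcases (normalizer_eq_top_iff.1 h).eq_bot_or_eq_top with h | h
      · exact hbot h
      · exact (hDM.trans hM.1.lt_top).ne h
    obtain ⟨P, hP, hNP⟩ := (eq_top_or_exists_le_coatom _).resolve_left hN
    have key : ∀ Q : Subgroup G, IsCoatom Q → M ⊓ L < Q → P = Q := fun Q hQ hDQ => by
      by_contra hPQ
      have := hnil Q hQ.1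
      have hlt : (M ⊓ L).subgroupOf Q < ⊤ := by
        rw [lt_top_iff_ne_top, ne_eq, subgroupOf_eq_top]
        exact hDQ.not_ge
      obtain ⟨x, hx, hxD⟩ := SetLike.exists_of_lt
        (Group.normalizerCondition_of_isNilpotent _ hlt)
      have hxN : (x : G) ∈ normalizer ((M ⊓ L : Subgroup G) : Set G) := by
        rw [mem_normalizer_iff] at hx ⊢
        intro y
        constructor
        · intro hy
          exact (hx ⟨y, hDQ.le hy⟩).1 hy
        · intro hy
          have hyQ : y ∈ Q := by
            have := mul_mem (mul_mem (inv_mem x.2) (hDQ.le hy)) x.2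
            simpa [mul_assoc] using this
          exact (hx ⟨y, hyQ⟩).2 hy
      have hDPQ : M ⊓ L < P ⊓ Q := by
        refine lt_of_le_of_ne (le_inf (le_normalizer.trans hNP) hDQ.le) fun h => hxD ?_
        rw [mem_subgroupOf, h]
        exact ⟨hNP hxN, x.2⟩
      have hcard : Nat.card ↥(M ⊓ L) < Nat.card ↥(P ⊓ Q) := by
        have h := Set.ncard_lt_ncard (s := ((M ⊓ L : Subgroup G) : Set G))
          (t := ((P ⊓ Q : Subgroup G) : Set G)) hDPQ
        rwa [← Nat.card_coe_set_eq, ← Nat.card_coe_set_eq] at h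
      have hle : Nat.card ↥(P ⊓ Q) ≤ Nat.card G := card_le_card_group _
      have := ih _ (by omega) hP hQ hPQ rfl
      exact not_lt_bot (this ▸ hDPQ)
    exact hne ((key M hM hDM).symm.trans (key L hL hDL))

/-- The set of nontrivial elements that are conjugate to an element of `M`. -/
def nontrivialConjugates (M : Subgroup G) : Set G :=
  {x | x ≠ 1 ∧ ∃ g : G, g⁻¹ * x * g ∈ M}

theorem map_conj_eq_of_mem_of_mem [IsSimpleGroup G]
    (hnil : ∀ H : Subgroup G, H ≠ ⊤ → Group.IsNilpotent H) {M L : Subgroup G}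
    (hM : IsCoatom M) (hL : IsCoatom L) {x g h : G} (hx : x ≠ 1) (hg : g⁻¹ * x * g ∈ M)
    (hh : h⁻¹ * x * h ∈ L) :
    M.map (MulAut.conj g).toMonoidHom = L.map (MulAut.conj h).toMonoidHom := by
  by_contra hne
  have := inf_eq_bot_of_isCoatom_of_ne_of_forall_isNilpotent hnil (isCoatom_map_conj hM g)
    (isCoatom_map_conj hL h) hne
  exact hx ((mem_bot).1 (this ▸ ⟨mem_map_conj_iff.2 hg, mem_map_conj_iff.2 hh⟩))

theorem ncard_nontrivialConjugates [IsSimpleGroup G]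
    (hnil : ∀ H : Subgroup G, H ≠ ⊤ → Group.IsNilpotent H) {M : Subgroup G} (hM : IsCoatom M)
    (hbot : M ≠ ⊥) : (nontrivialConjugates M).ncard + M.index = Nat.card G := by
  let f : (G ⧸ M) × {m : M // m ≠ 1} → nontrivialConjugates M := fun p =>
    ⟨p.1.out * p.2.1 * p.1.out⁻¹, by
      refine ⟨?_, p.1.out, by simp [mul_assoc]⟩
      rw [ne_eq, conj_eq_one_iff]
      exact fun h => p.2.2 (Subtype.ext h)⟩
  have hf : Function.Bijective f := by
    constructor
    · rintro ⟨q, m, hm⟩ ⟨q', m', hm'⟩ h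
      have h0 : q.out * m * q.out⁻¹ = q'.out * m' * q'.out⁻¹ := congrArg Subtype.val h
      have hq : q = q' := by
        rw [← q.out_eq', ← q'.out_eq', QuotientGroup.eq]
        refine mem_of_map_conj_eq_of_isCoatom hM hbot (map_conj_eq_of_mem_of_mem hnil hM hM
          (x := q.out * m * q.out⁻¹) (f (q, ⟨m, hm⟩)).2.1 ?_ ?_)
        · simp [mul_assoc]
        · rw [h0]; simp [mul_assoc]
      subst hq
      have : m = m' := Subtype.ext (by simpa using h0)
      subst this
      rfl
    · rintro ⟨x, hx, g, hg⟩
      obtain ⟨n, hn⟩ := QuotientGroup.mk_out_eq_mul M g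
      refine ⟨((g : G ⧸ M), ⟨⟨(n : G)⁻¹ * (g⁻¹ * x * g) * n,
        mul_mem (mul_mem (inv_mem n.2) hg) n.2⟩, fun h => hx ?_⟩), Subtype.ext ?_⟩
      · have h1 : (n : G)⁻¹ * (g⁻¹ * x * g) * n = 1 := congrArg Subtype.val h
        have h2 : ((g * n)⁻¹) * x * ((g * n)⁻¹)⁻¹ = 1 := by
          rw [← h1]; simp [mul_assoc]
        exact conj_eq_one_iff.1 h2
      · simp only [f, hn]
        group
  have h1 : (nontrivialConjugates M).ncard = M.index * (Nat.card M - 1) := by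
    rw [← Nat.card_coe_set_eq, ← Nat.card_congr (Equiv.ofBijective f hf), Nat.card_prod]
    congr 1
    have := Set.ncard_compl ({1} : Set M)
    rw [Set.ncard_singleton, ← Nat.card_coe_set_eq] at this
    exact this
  rw [h1, ← M.card_mul_index]
  obtain ⟨k, hk⟩ := Nat.exists_eq_succ_of_ne_zero (Nat.card_pos (α := M)).ne'
  rw [hk]
  simp only [Nat.succ_eq_add_one, Nat.add_sub_cancel]
  ring

/-- A finite simple group whose proper subgroups are all nilpotent is abelian. -/
theorem IsSimpleGroup.mul_comm_of_forall_isNilpotent [IsSimpleGroup G]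
    (hnil : ∀ H : Subgroup G, H ≠ ⊤ → Group.IsNilpotent H) (a b : G) : a * b = b * a := by
  by_contra hab
  have hzp : ∀ x : G, zpowers x ≠ ⊤ := fun x hx => hab <| by
    obtain ⟨i, rfl⟩ := mem_zpowers_iff.1 (hx ▸ mem_top a)
    obtain ⟨j, rfl⟩ := mem_zpowers_iff.1 (hx ▸ mem_top b)
    exact zpow_mul_comm x i j
  have hex : ∀ x : G, x ≠ 1 → ∃ M : Subgroup G, IsCoatom M ∧ x ∈ M ∧ M ≠ ⊥ := fun x hx => by
    obtain ⟨M, hM, hxM⟩ := (eq_top_or_exists_le_coatom _).resolve_left (hzp x)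
    rw [zpowers_le] at hxM
    exact ⟨M, hM, hxM, fun h => hx (mem_bot.1 (h ▸ hxM))⟩
  have hidx : ∀ M : Subgroup G, M ≠ ⊥ → 2 * M.index ≤ Nat.card G := fun M hM => by
    rw [← M.card_mul_index]
    exact Nat.mul_le_mul_right _ ((one_lt_card_iff_ne_bot M).2 hM)
  obtain ⟨x, hx⟩ := exists_ne (1 : G)
  obtain ⟨M, hM, -, hMbot⟩ := hex x hx
  have hMc := ncard_nontrivialConjugates hnil hM hMbot
  have hcompl : (({1} : Set G)ᶜ).ncard = Nat.card G - 1 := by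
    rw [Set.ncard_compl, Set.ncard_singleton]
  have hM1 : M.index ≠ 1 := fun h => hM.1 (index_eq_one.1 h)
  have hM0 : M.index ≠ 0 := index_ne_zero_of_finite
  obtain ⟨y, hy1, hyM⟩ : ∃ y : G, y ≠ 1 ∧ y ∉ nontrivialConjugates M := by
    by_contra! h
    have := Set.ncard_le_ncard (s := ({1} : Set G)ᶜ) (t := nontrivialConjugates M)
      (fun y hy => h y hy)
    omega
  obtain ⟨L, hL, hyL, hLbot⟩ := hex y hy1
  have hLc := ncard_nontrivialConjugates hnil hL hLbot
  have hdisj : Disjoint (nontrivialConjugates M) (nontrivialConjugates L) := by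
    rw [Set.disjoint_left]
    rintro z ⟨hz, g, hg⟩ ⟨-, h, hh⟩
    have hgh := map_conj_eq_of_mem_of_mem hnil hM hL hz hg hh
    refine hyM ⟨hy1, h⁻¹ * g, ?_⟩
    have : h * y * h⁻¹ ∈ L.map (MulAut.conj h).toMonoidHom :=
      mem_map_conj_iff.2 (by simpa [mul_assoc] using hyL)
    rw [← hgh, mem_map_conj_iff] at this
    simpa [mul_assoc] using this
  have hsub := Set.ncard_le_ncard (s := nontrivialConjugates M ∪ nontrivialConjugates L)
    (t := ({1} : Set G)ᶜ) (by rintro z (hz | hz) <;> exact hz.1)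
  rw [Set.ncard_union_eq hdisj] at hsub
  have h1 := hidx M hMbot
  have h2 := hidx L hLbot
  have := Nat.card_pos (α := G)
  omega

end Schmidt

section Solvable

open Subgroup

theorem Subgroup.forall_isNilpotent_quotient {G : Type*} [Group G] (N : Subgroup G) [N.Normal]
    (hnil : ∀ H : Subgroup G, H ≠ ⊤ → Group.IsNilpotent H) (H : Subgroup (G ⧸ N)) (hH : H ≠ ⊤) :
    Group.IsNilpotent H := by
  have hsurj := QuotientGroup.mk'_surjective N
  have := hnil (H.comap (QuotientGroup.mk' N)) fun h => hH <| by
    rw [← map_comap_eq_self_of_surjective hsurj H, h, ← MonoidHom.range_eq_map,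
      MonoidHom.range_eq_top.2 hsurj]
  exact Group.nilpotent_of_surjective _
    ((QuotientGroup.mk' N).subgroupComap_surjective_of_surjective H hsurj)

/-- A finite group whose proper subgroups are all nilpotent is solvable. -/
theorem isSolvable_of_finite_of_forall_isNilpotent {G : Type*} [Group G] [Finite G]
    (hnil : ∀ H : Subgroup G, H ≠ ⊤ → Group.IsNilpotent H) : Group.IsSolvable G := by
  induction h : Nat.card G using Nat.strong_induction_on generalizing G with
  | _ n ih =>
    rcases subsingleton_or_nontrivial G with hG | hG
    · exact Group.isSolvable_of_comm fun a b => Subsingleton.elim _ _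
    by_cases hs : ∀ N : Subgroup G, N.Normal → N = ⊥ ∨ N = ⊤
    · have : IsSimpleGroup G := ⟨hs⟩
      exact Group.isSolvable_of_comm (IsSimpleGroup.mul_comm_of_forall_isNilpotent hnil)
    · push Not at hs
      obtain ⟨N, hN, hbot, htop⟩ := hs
      have := hnil N htop
      have hlt : Nat.card (G ⧸ N) < n := by
        have h1 := N.card_eq_card_quotient_mul_card_subgroup
        have h2 := (one_lt_card_iff_ne_bot N).2 hbot
        have h3 : 0 < Nat.card (G ⧸ N) := Nat.card_pos
        nlinarith
      have hq := ih _ hlt (N.forall_isNilpotent_quotient hnil) rfl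
      exact (Group.isSolvable_iff_subgroup_quotient N).2 ⟨inferInstance, hq⟩

end Solvable
section FiniteAbelianization

open Subgroup

theorem finite_commutatorSet_of_finite_quotient_center {G : Type*} [Group G]
    [Finite (G ⧸ center G)] : Finite (commutatorSet G) := by
  have : commutatorSet G ⊆ Set.range fun p : (G ⧸ center G) × (G ⧸ center G) =>
      ⁅p.1.out, p.2.out⁆ := by
    rintro _ ⟨a, b, rfl⟩
    refine ⟨(a, b), ?_⟩
    obtain ⟨z, hz⟩ := QuotientGroup.mk_out_eq_mul (center G) a
    obtain ⟨w, hw⟩ := QuotientGroup.mk_out_eq_mul (center G) b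
    have hz' := fun x => (mem_center_iff.1 z.2 x)
    have hw' := fun x => (mem_center_iff.1 w.2 x)
    simp only [hz, hw, commutatorElement_def, mul_inv_rev]
    have h1 : a * z * (b * w) = (a * b) * (w * z) := by
      rw [mul_assoc a, ← hz' (b * w)]; group
    have h2 : a * z * (b * w) * ((z : G)⁻¹ * a⁻¹) * ((w : G)⁻¹ * b⁻¹) =
        a * b * (w * z * (z : G)⁻¹ * a⁻¹ * (w : G)⁻¹) * b⁻¹ := by
      rw [h1]; group
    have h3 : (w : G) * z * (z : G)⁻¹ * a⁻¹ * (w : G)⁻¹ = a⁻¹ := by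
      rw [mul_inv_cancel_right, ← hw', mul_inv_cancel_right]
    rw [h2, h3]
  exact ((Set.finite_range _).subset this).to_subtype

theorem finite_of_finite_commutator_of_finite_abelianization {G : Type*} [Group G]
    [Finite (commutator G)] [Finite (Abelianization G)] : Finite G := by
  have h1 : Nat.card (Abelianization G) ≠ 0 := Nat.card_pos.ne'
  refine Nat.finite_of_card_ne_zero ?_
  rw [(commutator G).card_eq_card_quotient_mul_card_subgroup]
  exact mul_ne_zero h1 Nat.card_pos.ne'

/-- A nilpotent group with finite abelianization is finite. -/
theorem Group.finite_of_isNilpotent_of_finite_abelianization {G : Type*} [Group G]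
    [Group.IsNilpotent G] [hfin : Finite (Abelianization G)] : Finite G := by
  refine (?_ : Finite (Abelianization G) → Finite G) hfin
  clear hfin
  apply Group.nilpotent_center_quotient_ind (P := fun G _ _ =>
    Finite (Abelianization G) → Finite G) G
  · intro G _ _ _
    infer_instance
  · intro G _ _ ih hG
    have : Finite (Abelianization (G ⧸ center G)) := by
      refine Finite.of_surjective (Abelianization.map (QuotientGroup.mk' (center G))) ?_
      intro x
      obtain ⟨y, rfl⟩ := QuotientGroup.mk_surjective x
      obtain ⟨z, rfl⟩ := QuotientGroup.mk_surjective y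
      exact ⟨Abelianization.of z, rfl⟩
    have := ih this
    have := finite_commutatorSet_of_finite_quotient_center (G := G)
    exact finite_of_finite_commutator_of_finite_abelianization

end FiniteAbelianization
section NilpotencyCriterion

open Subgroup

variable {G : Type*} [Group G]

theorem Subgroup.commutatorElement_mem_of_sup_zpowers_eq_top {W L : Subgroup G} [W.Normal]
    {y : G} (htop : L ⊔ zpowers y = ⊤) {x : G} (hL : ∀ l ∈ L, ⁅x, l⁆ ∈ W) (hy : ⁅x, y⁆ ∈ W)
    (g : G) : ⁅x, g⁆ ∈ W := by
  have key : ∀ g, g ∈ (centralizer {(x : G ⧸ W)}).comap (QuotientGroup.mk' W) ↔ ⁅x, g⁆ ∈ W := by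
    intro g
    rw [mem_comap, mem_centralizer_singleton_iff, ← QuotientGroup.eq_one_iff (N := W),
      ← QuotientGroup.mk'_apply W ⁅x, g⁆, map_commutatorElement,
      commutatorElement_eq_one_iff_mul_comm]
    exact eq_comm
  rw [← key]
  have hle : L ⊔ zpowers y ≤ (centralizer {(x : G ⧸ W)}).comap (QuotientGroup.mk' W) :=
    sup_le (fun l hl => (key l).2 (hL l hl)) ((zpowers_le).2 ((key y).2 hy))
  exact hle (htop ▸ mem_top g)

theorem Subgroup.iterate_commutatorElement_mem (T : Subgroup G) [T.Normal] (y : G) {t : G}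
    (ht : t ∈ T) (n : ℕ) : (fun g => ⁅g, y⁆)^[n] t ∈ T := by
  induction n generalizing t with
  | zero => exact ht
  | succ n ih =>
    rw [Function.iterate_succ_apply]
    refine ih ?_
    rw [commutatorElement_def, mul_assoc, mul_assoc]
    exact mul_mem ht (by simpa [mul_assoc] using ‹T.Normal›.conj_mem _ (inv_mem ht) y)

theorem Subgroup.iterate_commutatorElement_pow {T : Subgroup G} [T.Normal]
    (hT : ∀ a ∈ T, ∀ b ∈ T, Commute a b) (y : G) {t : G} (ht : t ∈ T) (r n : ℕ) :
    (fun g => ⁅g, y⁆)^[n] (t ^ r) = ((fun g => ⁅g, y⁆)^[n] t) ^ r := by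
  induction n with
  | zero => rfl
  | succ n ih =>
    rw [Function.iterate_succ_apply', Function.iterate_succ_apply', ih]
    have hu := T.iterate_commutatorElement_mem y ht n
    set u := (fun g => ⁅g, y⁆)^[n] t
    have hc : Commute u (y * u⁻¹ * y⁻¹) :=
      hT _ hu _ (‹T.Normal›.conj_mem _ (inv_mem hu) y)
    have h1 : ∀ v : G, ⁅v, y⁆ = v * (y * v⁻¹ * y⁻¹) := fun v => by
      rw [commutatorElement_def]; group
    rw [h1, h1, hc.mul_pow, conj_pow, inv_pow]

theorem Subgroup.mem_upperCentralSeries_of_iterate_commutatorElement_eq_one {L : Subgroup G}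
    {y : G} (htop : L ⊔ zpowers y = ⊤) (n : ℕ) {t : G} [L.Normal] (ht : t ∈ centralizer (L : Set G))
    (h : (fun g => ⁅g, y⁆)^[n] t = 1) : t ∈ upperCentralSeries G n := by
  induction n generalizing t with
  | zero => exact h
  | succ n ih =>
    rw [mem_upperCentralSeries_succ_iff]
    refine commutatorElement_mem_of_sup_zpowers_eq_top htop (fun l hl => ?_)
      (ih ((centralizer (L : Set G)).iterate_commutatorElement_mem y ht 1) h)
    rw [commutatorElement_eq_one_iff_mul_comm.2 (mem_centralizer_iff.1 ht l hl).symm]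
    exact one_mem _

theorem Subgroup.mem_upperCentralSeries_add {m n : ℕ} {x : G}
    (hx : (x : G ⧸ upperCentralSeries G m) ∈ upperCentralSeries (G ⧸ upperCentralSeries G m) n) :
    x ∈ upperCentralSeries G (m + n) := by
  induction n generalizing x with
  | zero => exact (QuotientGroup.eq_one_iff x).1 hx
  | succ n ih =>
    rw [← add_assoc, mem_upperCentralSeries_succ_iff]
    exact fun y => ih (hx y)

theorem Subgroup.iterate_commutatorElement_map {H : Type*} [Group H] (f : G →* H) (y t : G)
    (n : ℕ) : f ((fun g => ⁅g, y⁆)^[n] t) = (fun g => ⁅g, f y⁆)^[n] (f t) :=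
  Function.Semiconj.iterate_right (f := f) (fun g => map_commutatorElement f g y) n t

/-- If `L` is a nilpotent normal subgroup, `G` is generated by `L` and `y`, and `y` acts
unipotently both on the `r`-th and on the `s`-th powers in `L`, with `r` and `s` coprime, then `G`
is nilpotent. -/
theorem Subgroup.isNilpotent_of_iterate_commutatorElement_pow {L : Subgroup G} [L.Normal]
    [Group.IsNilpotent L] {y : G} (htop : L ⊔ zpowers y = ⊤) {r s n : ℕ} (hrs : r.Coprime s)
    (hr : ∀ l ∈ L, (fun g => ⁅g, y⁆)^[n] (l ^ r) = 1)
    (hs : ∀ l ∈ L, (fun g => ⁅g, y⁆)^[n] (l ^ s) = 1) : Group.IsNilpotent G := by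
  have key : ∀ i, ∃ m, ∀ x : L, x ∈ upperCentralSeries L i → (x : G) ∈ upperCentralSeries G m := by
    intro i
    induction i with
    | zero =>
      refine ⟨0, fun x hx => ?_⟩
      rw [upperCentralSeries_zero, mem_bot] at hx ⊢
      simp [hx]
    | succ i ih =>
      obtain ⟨m, hm⟩ := ih
      refine ⟨m + n, fun x hx => mem_upperCentralSeries_add ?_⟩
      have hsurj := QuotientGroup.mk'_surjective (upperCentralSeries G m)
      set π := QuotientGroup.mk' (upperCentralSeries G m)
      have hLn : (L.map π).Normal := Normal.map inferInstance π hsurj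
      have htop' : L.map π ⊔ zpowers (π y) = ⊤ := by
        rw [← MonoidHom.map_zpowers, ← map_sup, htop, ← MonoidHom.range_eq_map,
          MonoidHom.range_eq_top.2 hsurj]
      have hxC : π x ∈ centralizer (L.map π : Set (G ⧸ upperCentralSeries G m)) := by
        rw [mem_centralizer_iff]
        rintro _ ⟨l, hl, rfl⟩
        refine (commutatorElement_eq_one_iff_mul_comm.1 ?_).symm
        rw [← map_commutatorElement]
        exact (QuotientGroup.eq_one_iff _).2 (hm _ (hx ⟨l, hl⟩))
      have hT : ∀ a ∈ L.map π ⊓ centralizer (L.map π : Set (G ⧸ upperCentralSeries G m)),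
          ∀ b ∈ L.map π ⊓ centralizer (L.map π : Set (G ⧸ upperCentralSeries G m)),
          Commute a b := fun a ha b hb => mem_centralizer_iff.1 hb.2 a ha.1
      have hpow : ∀ k : ℕ, (∀ l ∈ L, (fun g => ⁅g, y⁆)^[n] (l ^ k) = 1) →
          ((fun g => ⁅g, π y⁆)^[n] (π x)) ^ k = 1 := fun k hk => by
        rw [← iterate_commutatorElement_pow hT _ ⟨mem_map_of_mem π x.2, hxC⟩, ← map_pow,
          ← iterate_commutatorElement_map, hk x x.2, map_one]
      refine mem_upperCentralSeries_of_iterate_commutatorElement_eq_one htop' n hxC ?_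
      have := pow_gcd_eq_one.2 ⟨hpow r hr, hpow s hs⟩
      rwa [hrs.gcd_eq_one, pow_one] at this
  obtain ⟨c, hc⟩ := Group.IsNilpotent.nilpotent L
  obtain ⟨m, hm⟩ := key c
  have hL : L ≤ upperCentralSeries G m := fun l hl => hm ⟨l, hl⟩ (hc ▸ mem_top _)
  refine ⟨m + 1, top_le_iff.1 (htop ▸ sup_le
    (hL.trans (upperCentralSeries_mono G (Nat.le_succ m))) (zpowers_le.2 ?_))⟩
  rw [mem_upperCentralSeries_succ_iff]
  refine commutatorElement_mem_of_sup_zpowers_eq_top htop (fun l hl => ?_) (by simp)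
  rw [commutatorElement_def]
  exact mul_mem (Normal.conj_mem inferInstance _ (hL hl) y) (inv_mem (hL hl))

end NilpotencyCriterion
section FinitelyGenerated

open Subgroup

theorem CommGroup.finite_of_fg_of_forall_exists_pow_eq {A : Type*} [CommGroup A] [Group.FG A]
    {r : ℕ} (hr : r ≠ 1) (h : ∀ a : A, ∃ b : A, b ^ r = a) : Finite A := by
  obtain ⟨k, hk, hk0⟩ := Submodule.exists_sub_one_mem_and_smul_eq_zero_of_fg_of_le_smul
    (Ideal.span {(r : ℤ)}) (⊤ : Submodule ℤ (Additive A))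
    (Module.finite_def.1 (Module.Finite.iff_addGroup_fg.2 inferInstance)) fun a _ => by
      obtain ⟨b, hb⟩ := h a.toMul
      have : a = (r : ℤ) • Additive.ofMul b := by
        rw [natCast_zsmul, ← ofMul_pow, hb, ofMul_toMul]
      rw [this]
      exact Submodule.smul_mem_smul (Ideal.mem_span_singleton_self _) trivial
  have hkne : k ≠ 0 := by
    rintro rfl
    rw [Ideal.mem_span_singleton, zero_sub, dvd_neg] at hk
    exact hr (by simpa using Int.natAbs_dvd_natAbs.2 hk)
  refine CommGroup.finite_of_fg_isMulTorsion A fun a => ?_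
  rw [isOfFinOrder_iff_zpow_eq_one]
  exact ⟨k, hkne, hk0 (Additive.ofMul a) trivial⟩

theorem Group.exists_characteristic_ne_top_of_isNilpotent_of_infinite {L : Type*} [Group L]
    [Group.IsNilpotent L] [Group.FG L] [Infinite L] {r : ℕ} (hr : r ≠ 1) :
    ∃ B : Subgroup L, B.Characteristic ∧ B ≠ ⊤ ∧ ∀ l : L, l ^ r ∈ B := by
  refine ⟨(powMonoidHom r : Abelianization L →* Abelianization L).range.comap Abelianization.of,
    ?_, fun htop => ?_, fun l => ⟨Abelianization.of l, by simp⟩⟩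
  · rw [characteristic_iff_le_comap]
    rintro ϕ x ⟨a, ha⟩
    refine ⟨Abelianization.map ϕ.toMonoidHom a, ?_⟩
    have : Abelianization.map ϕ.toMonoidHom (a ^ r) =
        Abelianization.map ϕ.toMonoidHom (Abelianization.of x) := congrArg _ ha
    rw [map_pow] at this
    exact this
  · have : Group.FG (Abelianization L) := QuotientGroup.fg _
    have : Finite (Abelianization L) :=
      CommGroup.finite_of_fg_of_forall_exists_pow_eq hr fun a => by
        obtain ⟨l, rfl⟩ := QuotientGroup.mk_surjective a
        have hl : l ∈ (⊤ : Subgroup L) := mem_top l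
        rw [← htop] at hl
        exact hl
    exact not_finite_iff_infinite.2 ‹Infinite L› Group.finite_of_isNilpotent_of_finite_abelianization

variable {G : Type*} [Group G]

theorem Subgroup.eq_top_of_lt_of_prime_index {L M : Subgroup G} (hq : L.index.Prime)
    (h : L < M) : M = ⊤ := by
  have h1 := relIndex_mul_index h.le
  rcases hq.eq_one_or_self_of_dvd _ (index_dvd_of_le h.le) with h2 | h2
  · exact index_eq_one.1 h2
  · rw [h2, Nat.mul_eq_right hq.ne_zero, relIndex_eq_one] at h1
    exact absurd h1 h.not_ge

theorem Subgroup.exists_normal_prime_index_of_finiteIndex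
    (hnil : ∀ H : Subgroup G, H ≠ ⊤ → Group.IsNilpotent H) {K : Subgroup G} (hK : K ≠ ⊤)
    [K.FiniteIndex] : ∃ L : Subgroup G, L.Normal ∧ L.index.Prime := by
  classical
  have hex : ∃ n, ∃ L : Subgroup G, L.Normal ∧ L ≠ ⊤ ∧ L.index = n ∧ n ≠ 0 :=
    ⟨_, K.normalCore, inferInstance, fun h => hK (top_le_iff.1 (h ▸ K.normalCore_le)), rfl,
      FiniteIndex.index_ne_zero⟩
  obtain ⟨L, hL, htop, hidx, hne⟩ := Nat.find_spec hex
  have hmin : ∀ M : Subgroup G, M.Normal → L ≤ M → M = L ∨ M = ⊤ := fun M hM hLM => by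
    by_contra! h
    have h0 : M.index ≠ 0 := fun h0 => hne (hidx ▸ Nat.eq_zero_of_zero_dvd
      (h0 ▸ index_dvd_of_le hLM))
    have h1 := Nat.find_min' hex ⟨M, hM, h.2, rfl, h0⟩
    have h2 := relIndex_mul_index hLM
    have h3 : L.relIndex M ≠ 1 := fun h3 => h.1 (le_antisymm (relIndex_eq_one.1 h3) hLM)
    have h4 : L.relIndex M ≠ 0 := fun h4 => hne (by rw [← hidx, ← h2, h4, zero_mul])
    rw [← hidx, ← h2] at h1
    have : 2 ≤ L.relIndex M := by omega
    nlinarith [Nat.pos_of_ne_zero h0]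
  have hfin : L.FiniteIndex := ⟨hidx ▸ hne⟩
  have hsurj := QuotientGroup.mk'_surjective L
  have hnt : Nontrivial (G ⧸ L) := QuotientGroup.nontrivial_iff.2 htop
  have hsimple : IsSimpleGroup (G ⧸ L) := ⟨fun N hN => by
    rcases hmin (N.comap (QuotientGroup.mk' L)) inferInstance
      (fun x hx => by simp [(QuotientGroup.eq_one_iff x).2 hx, one_mem]) with h | h
    · left
      rw [← map_comap_eq_self_of_surjective hsurj N, h, QuotientGroup.map_mk'_self]
    · right
      rw [← map_comap_eq_self_of_surjective hsurj N, h, ← MonoidHom.range_eq_map,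
        MonoidHom.range_eq_top.2 hsurj]⟩
  let _ : CommGroup (G ⧸ L) := { (inferInstance : Group (G ⧸ L)) with
    mul_comm := IsSimpleGroup.mul_comm_of_forall_isNilpotent (L.forall_isNilpotent_quotient hnil) }
  exact ⟨L, hL, IsSimpleGroup.prime_card (α := G ⧸ L)⟩

theorem Subgroup.sup_zpowers_ne_top {B L : Subgroup G} [B.Normal] [L.Normal] (hBL : B < L)
    (hq : L.index.Prime) {y : G} (hy : y ∉ L) (hyq : y ^ L.index ∈ B) : B ⊔ zpowers y ≠ ⊤ := by
  intro htop
  obtain ⟨l, hl, hlB⟩ := SetLike.exists_of_lt hBL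
  obtain ⟨b, hb, z, hz, rfl⟩ := mem_sup_of_normal_left.1 (htop ▸ mem_top l : l ∈ B ⊔ zpowers y)
  obtain ⟨k, rfl⟩ := mem_zpowers_iff.1 hz
  have hyk : y ^ k ∈ L := (mul_mem_cancel_left (hBL.le hb)).1 hl
  have := Fact.mk hq
  have hord : orderOf (y : G ⧸ L) = L.index := by
    refine orderOf_eq_prime ?_ fun h => hy ((QuotientGroup.eq_one_iff y).1 h)
    rw [← QuotientGroup.mk_pow]
    exact (QuotientGroup.eq_one_iff _).2 (hBL.le hyq)
  have hdvd : (L.index : ℤ) ∣ k := by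
    rw [← hord, orderOf_dvd_iff_zpow_eq_one, ← QuotientGroup.mk_zpow]
    exact (QuotientGroup.eq_one_iff _).2 hyk
  obtain ⟨j, rfl⟩ := hdvd
  rw [zpow_mul, zpow_natCast] at hlB
  exact hlB (mul_mem hb (zpow_mem hyq j))

theorem Subgroup.exists_iterate_commutatorElement_eq_one {S : Subgroup G} [Group.IsNilpotent S]
    {y : G} (hy : y ∈ S) : ∃ n, ∀ m, n ≤ m → ∀ x ∈ S, (fun g => ⁅g, y⁆)^[m] x = 1 := by
  obtain ⟨n, hn⟩ := (isNilpotent_iff_lowerCentralSeries S).1 inferInstance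
  refine ⟨n, fun m hm x hx => ?_⟩
  have key : ∀ i, (fun g => ⁅g, y⁆)^[i] x ∈ S.lowerCentralSeries i := fun i => by
    induction i with
    | zero => exact hx
    | succ i ih =>
      rw [Function.iterate_succ_apply']
      exact commutator_mem_commutator ih hy
  exact mem_bot.1 (hn ▸ S.lowerCentralSeries_antitone hm (key m))

/-- A finitely generated group with a proper subgroup of finite index, whose proper subgroups are
all nilpotent, is nilpotent or finite. -/
theorem Group.finite_of_fg_of_not_isNilpotent [Group.FG G] (hG : ¬ Group.IsNilpotent G)
    (hnil : ∀ H : Subgroup G, H ≠ ⊤ → Group.IsNilpotent H) {K : Subgroup G} (hK : K ≠ ⊤)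
    [K.FiniteIndex] : Finite G := by
  obtain ⟨L, hL, hq⟩ := exists_normal_prime_index_of_finiteIndex hnil hK
  have hfi : L.FiniteIndex := ⟨hq.ne_zero⟩
  have hLtop : L ≠ ⊤ := fun h => hq.ne_one (index_eq_one.2 h)
  have hLnil := hnil L hLtop
  have hLfg : Group.FG L := inferInstance
  by_contra hinf
  rw [not_finite_iff_infinite] at hinf
  have hLinf : Infinite L := by
    rw [← not_finite_iff_infinite]
    intro h
    refine not_finite_iff_infinite.2 hinf (Nat.finite_of_card_ne_zero ?_)
    rw [← L.card_mul_index]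
    exact mul_ne_zero Nat.card_pos.ne' hq.ne_zero
  obtain ⟨r, hqr, hr⟩ := Nat.exists_infinite_primes (L.index + 1)
  obtain ⟨s, hrs, hs⟩ := Nat.exists_infinite_primes (r + 1)
  obtain ⟨y₀, -, hy₀⟩ := SetLike.exists_of_lt hLtop.lt_top
  have hy₀q : y₀ ^ L.index ∈ L := L.pow_index_mem y₀
  have hcop : (r * s).Coprime L.index := Nat.Coprime.mul_left
    ((Nat.coprime_primes hr hq).2 (by omega)) ((Nat.coprime_primes hs hq).2 (by omega))
  have hy : y₀ ^ (r * s) ∉ L := fun h => hy₀ <| by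
    rw [← QuotientGroup.eq_one_iff] at h hy₀q ⊢
    rw [QuotientGroup.mk_pow] at h hy₀q
    have := pow_gcd_eq_one.2 ⟨h, hy₀q⟩
    rwa [hcop.gcd_eq_one, pow_one] at this
  have htop : L ⊔ zpowers (y₀ ^ (r * s)) = ⊤ := eq_top_of_lt_of_prime_index hq
    (left_lt_sup.2 fun h => hy (h (mem_zpowers _)))
  have key : ∀ p : ℕ, p ≠ 1 → p ∣ r * s → ∃ n, ∀ m, n ≤ m → ∀ l ∈ L,
      (fun g => ⁅g, y₀ ^ (r * s)⁆)^[m] (l ^ p) = 1 := fun p hp ⟨t, ht⟩ => by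
    obtain ⟨B, hB, hBtop, hBp⟩ :=
      Group.exists_characteristic_ne_top_of_isNilpotent_of_infinite (L := L) hp
    have hBL : B.map L.subtype < L := (map_subtype_le B).lt_of_ne fun h => hBtop <| by
      apply map_injective L.subtype_injective
      rw [h, ← MonoidHom.range_eq_map, range_subtype]
    have hyB : (y₀ ^ (r * s)) ^ L.index ∈ B.map L.subtype := by
      refine ⟨(⟨y₀ ^ L.index, hy₀q⟩ ^ t) ^ p, hBp _, ?_⟩
      simp only [map_pow, subtype_apply, ← pow_mul, ht]
      congr 1
      ring
    have := hnil _ (sup_zpowers_ne_top hBL hq hy hyB)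
    obtain ⟨n, hn⟩ := exists_iterate_commutatorElement_eq_one
      (S := B.map L.subtype ⊔ zpowers (y₀ ^ (r * s))) (mem_sup_right (mem_zpowers _))
    exact ⟨n, fun m hm l hl => hn m hm _ (mem_sup_left ⟨_, hBp ⟨l, hl⟩, rfl⟩)⟩
  obtain ⟨n, hn⟩ := key r hr.ne_one (dvd_mul_right _ _)
  obtain ⟨m, hm⟩ := key s hs.ne_one (dvd_mul_left _ _)
  exact hG (isNilpotent_of_iterate_commutatorElement_pow htop
    ((Nat.coprime_primes hr hs).2 (by omega)) (hn _ (le_max_left n m)) (hm _ (le_max_right n m)))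

end FinitelyGenerated
section NormalOvergroups

open Subgroup

variable {G : Type*} [Group G]

theorem Subgroup.normal_quotient_of_forall_normal {N : Subgroup G} [N.Normal]
    (hD : ∀ K : Subgroup G, N ≤ K → K.Normal) (K : Subgroup (G ⧸ N)) : K.Normal := by
  have hsurj := QuotientGroup.mk'_surjective N
  rw [← map_comap_eq_self_of_surjective hsurj K]
  exact (hD _ fun x hx => by simp [(QuotientGroup.eq_one_iff x).2 hx, one_mem]).map _ hsurj

theorem finite_commutator_of_finite_of_forall_normal {N : Subgroup G} [N.Normal] [Finite N]
    (hD : ∀ K : Subgroup G, N ≤ K → K.Normal) : Finite (commutator G) := by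
  have := finite_commutatorSet_of_forall_normal (normal_quotient_of_forall_normal hD)
  have hcomm : Finite (commutator (G ⧸ N)) := inferInstance
  have hfin : (commutator (G ⧸ N) : Set (G ⧸ N)).Finite := Set.finite_coe_iff.1 hcomm
  have hpre : ((fun g : G => (g : G ⧸ N)) ⁻¹' (commutator (G ⧸ N) : Set (G ⧸ N))).Finite := by
    refine hfin.preimage' fun b _ => ?_
    obtain ⟨g, rfl⟩ := QuotientGroup.mk_surjective b
    refine ((Set.toFinite (N : Set G)).image fun n => g * n).subset fun x hx => ?_
    exact ⟨g⁻¹ * x, QuotientGroup.eq.1 (Set.mem_singleton_iff.1 hx).symm, by simp⟩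
  refine (hpre.subset fun x hx => ?_).to_subtype
  have hmap : (commutator G).map (QuotientGroup.mk' N) ≤ commutator (G ⧸ N) := by
    rw [_root_.commutator_def, map_commutator, _root_.commutator_def]
    exact commutator_mono le_top le_top
  exact hmap (mem_map_of_mem _ hx)

theorem isSolvable_of_isSolvable_of_forall_normal {N : Subgroup G} [N.Normal] [Group.IsSolvable N]
    (hD : ∀ K : Subgroup G, N ≤ K → K.Normal) : Group.IsSolvable G :=
  (Group.isSolvable_iff_subgroup_quotient N).2
    ⟨inferInstance, isSolvable_of_forall_normal (normal_quotient_of_forall_normal hD)⟩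

end NormalOvergroups
section ParaNilHamiltonian

open Subgroup

variable {G : Type*} [Group G]

theorem LocallyGraded.exists_lt_index [Group.FG G] [Infinite G] (h : LocallyGraded G) (n : ℕ) :
    ∃ K : Subgroup G, K.FiniteIndex ∧ n < K.index := by
  induction n with
  | zero => exact ⟨⊤, inferInstance, by simp⟩
  | succ n ih =>
    obtain ⟨K, hK, hn⟩ := ih
    have hKbot : K ≠ ⊥ := by
      rintro rfl
      exact hK.index_ne_zero (by rw [index_bot, Nat.card_eq_zero_of_infinite])
    obtain ⟨K₁, htop, hfin⟩ := h K hKbot inferInstance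
    have hidx : (K₁.map K.subtype).index = K₁.index * K.index := by
      rw [index_map_subtype]
    have h0 : K₁.index ≠ 0 := hfin.index_ne_zero
    have h1 : K₁.index ≠ 1 := fun h => htop (index_eq_one.1 h)
    refine ⟨K₁.map K.subtype, ⟨?_⟩, ?_⟩
    · rw [hidx]
      exact mul_ne_zero h0 hK.index_ne_zero
    · rw [hidx]
      have : 2 ≤ K₁.index := by omega
      nlinarith

theorem ParaNilHamiltonian.normal_of_lt (hpara : ParaNilHamiltonian G) {X H : Subgroup G}
    (hX : ¬ Group.IsNilpotent X) (hXH : X < H) : H.Normal := by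
  by_contra hH
  have hnil : Group.IsNilpotent (X.subgroupOf H) := by
    rcases hpara.2 H hH with h | h
    · infer_instance
    · exact h.2 _ fun htop => hXH.not_ge (subgroupOf_eq_top.1 htop)
  exact hX ((Group.isNilpotent_congr (subgroupOfEquivOfLe hXH.le)).1 hnil)

theorem MinimalNonNilpotent.finite_of_le_of_locallyGraded {X M : Subgroup G}
    (hXmin : MinimalNonNilpotent X) [Group.FG X] (hXM : X ≤ M) (hlg : LocallyGraded M) :
    Finite X := by
  have hbot : X.subgroupOf M ≠ ⊥ := fun h => hXmin.1 <| by
    rw [subgroupOf_eq_bot, disjoint_of_le_iff_left_eq_bot hXM] at h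
    subst h
    infer_instance
  let e := subgroupOfEquivOfLe hXM
  obtain ⟨K, hK, hfin⟩ := hlg _ hbot
    (Group.fg_of_surjective (f := e.symm.toMonoidHom) e.symm.surjective)
  have hidx : (K.map e.toMonoidHom).index = K.index := index_map_equiv K e
  have : (K.map e.toMonoidHom).FiniteIndex := ⟨hidx ▸ hfin.index_ne_zero⟩
  refine Group.finite_of_fg_of_not_isNilpotent hXmin.1 hXmin.2 (K := K.map e.toMonoidHom)
    fun h => hK ?_
  rw [← index_eq_one, ← hidx, h, index_top]

theorem ParaNilHamiltonian.finite_normalClosure (hpara : ParaNilHamiltonian G) {X : Subgroup G}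
    [Group.FG X] (hXmin : MinimalNonNilpotent X)
    (hlg : LocallyGraded (normalClosure (X : Set G))) :
    Finite (normalClosure (X : Set G)) := by
  have hXM : X ≤ normalClosure (X : Set G) := subset_normalClosure
  have hXfin := hXmin.finite_of_le_of_locallyGraded hXM hlg
  have hle : ∀ H : Subgroup G, X < H → normalClosure (X : Set G) ≤ H := fun H hXH =>
    have := hpara.normal_of_lt hXmin.1 hXH
    normalClosure_le_normal hXH.le
  set M := normalClosure (X : Set G)
  rcases hXM.eq_or_lt with h | h
  · exact h ▸ hXfin
  obtain ⟨m, hm, hmX⟩ := SetLike.exists_of_lt h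
  have hMeq : X ⊔ zpowers m = M := le_antisymm (sup_le hXM (zpowers_le.2 hm))
    (hle _ (left_lt_sup.2 fun h => hmX (h (mem_zpowers m))))
  have hMfg : Group.FG M := by
    rw [Group.fg_iff_subgroup_fg, ← hMeq]
    exact ((Group.fg_iff_subgroup_fg X).1 inferInstance).sup
      ((Subgroup.fg_iff _).2 ⟨{m}, (zpowers_eq_closure m).symm, Set.finite_singleton m⟩)
  by_contra hinf
  rw [not_finite_iff_infinite] at hinf
  obtain ⟨K, hK, hlt⟩ := hlg.exists_lt_index (Nat.card X)
  set X₁ := X.subgroupOf M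
  have hcard : Nat.card X₁ = Nat.card X := Nat.card_congr (subgroupOfEquivOfLe hXM).toEquiv
  have hX₁ : Finite X₁ := Finite.of_equiv _ (subgroupOfEquivOfLe hXM).symm.toEquiv
  have hne : X₁ ⊔ K.normalCore ≠ ⊤ := fun htop => by
    have h1 : K.normalCore.index = K.normalCore.relIndex X₁ := by
      rw [← relIndex_sup_right, htop, relIndex_top_right]
    have h2 : K.normalCore.relIndex X₁ ≤ Nat.card X₁ :=
      Nat.le_of_dvd Nat.card_pos (index_dvd_card _)
    have h3 : K.index ≤ K.normalCore.index := Nat.le_of_dvd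
      (Nat.pos_of_ne_zero K.finiteIndex_normalCore.index_ne_zero)
      (index_dvd_of_le K.normalCore_le)
    omega
  have hXH : X ≤ (X₁ ⊔ K.normalCore).map M.subtype := by
    intro x hx
    exact ⟨⟨x, hXM hx⟩, mem_sup_left hx, rfl⟩
  have hXeq : X = (X₁ ⊔ K.normalCore).map M.subtype := by
    by_contra hXne
    refine hne (top_le_iff.1 fun x _ => ?_)
    obtain ⟨z, hz, hzx⟩ := hle _ (hXH.lt_of_ne hXne) x.2
    rwa [← Subtype.ext hzx]
  have hKX : K.normalCore ≤ X₁ := fun k hk => by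
    rw [mem_subgroupOf, hXeq]
    exact ⟨k, mem_sup_right hk, rfl⟩
  refine not_finite_iff_infinite.2 hinf (Nat.finite_of_card_ne_zero ?_)
  rw [← X₁.card_mul_index]
  exact mul_ne_zero Nat.card_pos.ne' fun h0 => K.finiteIndex_normalCore.index_ne_zero
    (Nat.eq_zero_of_zero_dvd (h0 ▸ index_dvd_of_le hKX))

theorem Subgroup.exists_commute_notMem_of_infinite [Infinite G] (M : Subgroup G) [M.Normal]
    [Finite M] : ∃ c : G, c ∉ M ∧ ∀ x ∈ M, Commute x c := by
  have hfin : Finite (MulAut M) := Finite.of_injective (fun e : MulAut M => e.toEquiv) fun e f h =>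
    MulEquiv.ext fun x => congrArg (fun e : Equiv.Perm M => e x) h
  have hidx : ((MulAut.conjNormal : G →* MulAut M)).ker.FiniteIndex := finiteIndex_ker _
  obtain ⟨c, hc, hcM⟩ : ∃ c ∈ (MulAut.conjNormal : G →* MulAut M).ker, c ∉ M := by
    by_contra! h
    have hM : M.index ≠ 0 := fun h0 => hidx.index_ne_zero
      (Nat.eq_zero_of_zero_dvd (h0 ▸ index_dvd_of_le h))
    refine not_finite_iff_infinite.2 ‹Infinite G› (Nat.finite_of_card_ne_zero ?_)
    rw [← M.card_mul_index]
    exact mul_ne_zero Nat.card_pos.ne' hM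
  refine ⟨c, hcM, fun x hx => ?_⟩
  have h1 : MulAut.conjNormal c (⟨x, hx⟩ : M) = ⟨x, hx⟩ := by
    rw [MonoidHom.mem_ker.1 hc]; rfl
  have h2 : c * x * c⁻¹ = x := by
    simpa only [MulAut.conjNormal_apply] using congrArg Subtype.val h1
  exact (mul_inv_eq_iff_eq_mul.1 h2).symm

theorem Subgroup.isSolvable_sup_zpowers_of_commute {X : Subgroup G} [Group.IsSolvable X] {c : G}
    (hc : ∀ x ∈ X, Commute x c) : Group.IsSolvable ↥(X ⊔ zpowers c) := by
  have hcomm : ∀ (x : X) (z : zpowers c), Commute (X.subtype x) ((zpowers c).subtype z) := by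
    rintro ⟨x, hx⟩ ⟨_, k, rfl⟩
    exact (hc x hx).zpow_right k
  have hz : Group.IsSolvable (zpowers c) := Group.isSolvable_of_comm fun a b =>
    Subtype.ext (setLike_mul_comm a.2 b.2)
  have hrange : (X.subtype.noncommCoprod (zpowers c).subtype hcomm).range = X ⊔ zpowers c := by
    rw [MonoidHom.noncommCoprod_range, range_subtype, range_subtype]
  rw [← hrange]
  exact Group.isSolvable_of_surjective (MonoidHom.rangeRestrict_surjective _)

end ParaNilHamiltonian

/-- If a para-Nil-Hamiltonian group $G$ has a finitely generated minimal non-nilpotent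
subgroup $X$ whose normal closure $X^G$ is locally graded, then $G'$ is finite;
furthermore if $X \trianglelefteq G$ or $G$ is infinite, then $G$ is soluble. -/
theorem stmt_12 {G : Type*} [Group G] (hpara : ParaNilHamiltonian G) (X : Subgroup G)
    (hXfg : Group.FG X) (hXmin : MinimalNonNilpotent X)
    (hlg : LocallyGraded (Subgroup.normalClosure (X : Set G))) :
    Finite (commutator G) ∧ ((X.Normal ∨ Infinite G) → IsSolvable G) := by
  have hXM : X ≤ Subgroup.normalClosure (X : Set G) := Subgroup.subset_normalClosure
  have hXfin : Finite X := hXmin.finite_of_le_of_locallyGraded hXM hlg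
  have hMfin : Finite (Subgroup.normalClosure (X : Set G)) := hpara.finite_normalClosure hXmin hlg
  have hover : ∀ H K : Subgroup G, H.Normal → X ≤ H → H ≤ K → K.Normal := by
    intro H K hH hXH hHK
    rcases (hXH.trans hHK).eq_or_lt with h | h
    · rwa [← le_antisymm hHK (h ▸ hXH)]
    · exact hpara.normal_of_lt hXmin.1 h
  refine ⟨finite_commutator_of_finite_of_forall_normal
    (fun K hK => hover _ K Subgroup.normalClosure_normal hXM hK), fun hor => ?_⟩
  have hXsol : Group.IsSolvable X := isSolvable_of_finite_of_forall_isNilpotent hXmin.2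
  by_cases hXn : X.Normal
  · exact isSolvable_of_isSolvable_of_forall_normal (fun K hK => hover X K hXn le_rfl hK)
  · have hinf := hor.resolve_left hXn
    obtain ⟨c, hcM, hc⟩ :=
      (Subgroup.normalClosure (X : Set G)).exists_commute_notMem_of_infinite
    have hlt : X < X ⊔ Subgroup.zpowers c :=
      left_lt_sup.2 fun h => hcM (hXM (h (Subgroup.mem_zpowers c)))
    have hn := hpara.normal_of_lt hXmin.1 hlt
    have hs := Subgroup.isSolvable_sup_zpowers_of_commute fun x hx => hc x (hXM hx)
    exact isSolvable_of_isSolvable_of_forall_normal (fun K hK => hover _ K hn hlt.le hK)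
end
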